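/- Let n ≥ 2 and suppose the cluster pattern with initial seed (B, (u_1,…,u_n)) is of type C_n. Let y be a cluster variable of the pattern with y ∉ {u_1,…,u_n} and denominator vector den(y) = (d_1,…,d_n). Then for each 1 ≤ i ≤ n, d_i = 0 if and only if there exists a cluster of the pattern containing both y and u_i. -/

import Mathlib

open MvPolynomial Matrix

noncomputable section

/-- The ambient field `ℚ(u_1, …, u_n)`. -/
abbrev CAField (n : ℕ) : Type := FractionRing (MvPolynomial (Fin n) ℚ)

/-- The initial cluster variables `u_i`. -/
def uVar (n : ℕ) (i : Fin n) : CAField n :=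
  algebraMap (MvPolynomial (Fin n) ℚ) (CAField n) (X i)

/-- Fomin–Zelevinsky matrix mutation in direction `k`. -/
def mutMat {n : ℕ} (k : Fin n) (B : Matrix (Fin n) (Fin n) ℤ) :
    Matrix (Fin n) (Fin n) ℤ := fun i j =>
  if i = k ∨ j = k then -B i j
  else B i j + (B i k).sign * max (B i k * B k j) 0

/-- Seed mutation in direction `k`: the matrix mutates by `mutMat` and the
`k`-th cluster variable `x_k` is replaced by
`(∏ x_i^{[B_ik]_+} + ∏ x_i^{[-B_ik]_+}) / x_k`. -/
def mutSeed {n : ℕ} (k : Fin n)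
    (s : Matrix (Fin n) (Fin n) ℤ × (Fin n → CAField n)) :
    Matrix (Fin n) (Fin n) ℤ × (Fin n → CAField n) :=
  (mutMat k s.1,
    Function.update s.2 k
      ((∏ i, s.2 i ^ (s.1 i k).toNat + ∏ i, s.2 i ^ (-(s.1 i k)).toNat) / s.2 k))

/-- The seeds of the cluster pattern with initial exchange matrix `B₀` and
initial cluster `(u_1, …, u_n)`: all seeds reachable from the initial seed
by finite sequences of mutations. -/
def IsSeed {n : ℕ} (B₀ : Matrix (Fin n) (Fin n) ℤ)
    (s : Matrix (Fin n) (Fin n) ℤ × (Fin n → CAField n)) : Prop :=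
  Relation.ReflTransGen (fun a b => ∃ k, b = mutSeed k a) (B₀, uVar n) s

/-- `B` is skew-symmetrizable: `D * B` is skew-symmetric for some diagonal `D`
with positive integer diagonal entries. -/
def SkewSymmetrizable {n : ℕ} (B : Matrix (Fin n) (Fin n) ℤ) : Prop :=
  ∃ d : Fin n → ℤ, (∀ i, 0 < d i) ∧
    (Matrix.diagonal d * B)ᵀ = -(Matrix.diagonal d * B)

/-- The Cartan counterpart `A(B)` of `B`. -/
def cartanCounterpart {n : ℕ} (B : Matrix (Fin n) (Fin n) ℤ) :
    Matrix (Fin n) (Fin n) ℤ := fun i j => if i = j then 2 else -|B i j|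

/-- The Cartan matrix of type `C_n` (with rows and columns indexed by
`0, …, n-1`): `2` on the diagonal, `-2` in position `(n-2, n-1)`, and `-1`
in the remaining positions `(i, i±1)`. -/
def cartanC (n : ℕ) : Matrix (Fin n) (Fin n) ℤ := fun i j =>
  if i = j then 2
  else if i.val + 2 = n ∧ j.val + 1 = n then -2
  else if i.val + 1 = j.val ∨ j.val + 1 = i.val then -1 else 0

/-- The cluster pattern with initial matrix `B₀` is of the finite type with
Cartan matrix `Cmat`: some seed of the pattern has exchange matrix whose
Cartan counterpart equals `Cmat` up to simultaneous permutation of rows and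
columns. -/
def PatternOfType {n : ℕ} (Cmat B₀ : Matrix (Fin n) (Fin n) ℤ) : Prop :=
  ∃ s, IsSeed B₀ s ∧ ∃ σ : Equiv.Perm (Fin n),
    ∀ i j, cartanCounterpart s.1 (σ i) (σ j) = Cmat i j

/-- `d` is the denominator vector of `y` with respect to the cluster `z`:
`y = f(z_1, …, z_n) / ∏ z_i^{d_i}` with `f` an integer polynomial not
divisible by any variable. -/
def IsDenomVec {n : ℕ} (z : Fin n → CAField n) (y : CAField n)
    (d : Fin n → ℤ) : Prop :=
  ∃ f : MvPolynomial (Fin n) ℤ, (∀ i, ¬ X i ∣ f) ∧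
    y = MvPolynomial.aeval z f / ∏ i, z i ^ d i

/-- `y` is a cluster variable of the pattern with initial matrix `B₀`. -/
def IsClusterVar {n : ℕ} (B₀ : Matrix (Fin n) (Fin n) ℤ) (y : CAField n) : Prop :=
  ∃ s, IsSeed B₀ s ∧ ∃ j, s.2 j = y


section proofs

/-! ### Part 1: orders along `u_i` -/

/-- The point with `i`-th coordinate `0` and all others `1`. -/
def ePt {n : ℕ} (i : Fin n) : Fin n → ℚ := fun j => if j = i then 0 else 1

/-- `z = u_i ^ w * P / Q` with `P, Q` positive at `ePt i`. -/
def HasOrd {n : ℕ} (i : Fin n) (z : CAField n) (w : ℤ) : Prop :=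
  ∃ P Q : MvPolynomial (Fin n) ℚ, 0 < eval (ePt i) P ∧ 0 < eval (ePt i) Q ∧
    z = uVar n i ^ w * (algebraMap (MvPolynomial (Fin n) ℚ) (CAField n) P /
      algebraMap (MvPolynomial (Fin n) ℚ) (CAField n) Q)

theorem uVar_ne_zero {n : ℕ} (i : Fin n) : uVar n i ≠ 0 := by
  unfold uVar
  rw [Ne, FaithfulSMul.algebraMap_eq_zero_iff]
  exact X_ne_zero i

theorem algMap_ne_zero_of_eval {n : ℕ} {e : Fin n → ℚ} {P : MvPolynomial (Fin n) ℚ}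
    (h : 0 < eval e P) : algebraMap (MvPolynomial (Fin n) ℚ) (CAField n) P ≠ 0 := by
  rw [Ne, FaithfulSMul.algebraMap_eq_zero_iff]
  rintro rfl
  simp at h

namespace HasOrd

variable {n : ℕ} {i : Fin n}

theorem ne_zero {z : CAField n} {w : ℤ} (h : HasOrd i z w) : z ≠ 0 := by
  obtain ⟨P, Q, hP, hQ, rfl⟩ := h
  exact mul_ne_zero (zpow_ne_zero _ (uVar_ne_zero i))
    (div_ne_zero (algMap_ne_zero_of_eval hP) (algMap_ne_zero_of_eval hQ))

theorem one : HasOrd i (1 : CAField n) 0 := ⟨1, 1, by simp, by simp, by simp⟩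

theorem mul {z z' : CAField n} {w w' : ℤ} (h : HasOrd i z w) (h' : HasOrd i z' w') :
    HasOrd i (z * z') (w + w') := by
  obtain ⟨P, Q, hP, hQ, rfl⟩ := h
  obtain ⟨P', Q', hP', hQ', rfl⟩ := h'
  refine ⟨P * P', Q * Q', by simpa using mul_pos hP hP', by simpa using mul_pos hQ hQ', ?_⟩
  rw [zpow_add₀ (uVar_ne_zero i), map_mul, map_mul]
  ring

theorem inv {z : CAField n} {w : ℤ} (h : HasOrd i z w) : HasOrd i z⁻¹ (-w) := by
  obtain ⟨P, Q, hP, hQ, rfl⟩ := h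
  refine ⟨Q, P, hQ, hP, ?_⟩
  rw [mul_inv, inv_div, _root_.zpow_neg]

theorem div {z z' : CAField n} {w w' : ℤ} (h : HasOrd i z w) (h' : HasOrd i z' w') :
    HasOrd i (z / z') (w - w') := by
  rw [div_eq_mul_inv, sub_eq_add_neg]
  exact h.mul h'.inv

theorem add_le {z z' : CAField n} {w w' : ℤ} (h : HasOrd i z w) (h' : HasOrd i z' w')
    (hw : w ≤ w') : HasOrd i (z + z') w := by
  obtain ⟨P, Q, hP, hQ, rfl⟩ := h
  obtain ⟨P', Q', hP', hQ', rfl⟩ := h'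
  obtain ⟨m, rfl⟩ := Int.le.dest hw
  have h1 := algMap_ne_zero_of_eval hQ
  have h2 := algMap_ne_zero_of_eval hQ'
  refine ⟨P * Q' + X i ^ m * (P' * Q), Q * Q', ?_, by simpa using mul_pos hQ hQ', ?_⟩
  · have hx : 0 ≤ ePt i i ^ m := by simp only [ePt, if_true]; positivity
    have := mul_nonneg hx (mul_pos hP' hQ).le
    have := mul_pos hP hQ'
    simp only [map_add, map_mul, map_pow, eval_X]
    linarith
  · rw [zpow_add₀ (uVar_ne_zero i), zpow_natCast]
    simp only [map_add, map_mul, map_pow]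
    change _ = uVar n i ^ w * ((_ + uVar n i ^ m * _) / _)
    field_simp

theorem add {z z' : CAField n} {w w' : ℤ} (h : HasOrd i z w) (h' : HasOrd i z' w') :
    HasOrd i (z + z') (min w w') := by
  rcases le_total w w' with hw | hw
  · rw [min_eq_left hw]; exact h.add_le h' hw
  · rw [min_eq_right hw, add_comm]; exact h'.add_le h hw

theorem pow {z : CAField n} {w : ℤ} (h : HasOrd i z w) (m : ℕ) :
    HasOrd i (z ^ m) (m * w) := by
  induction m with
  | zero => simpa using one
  | succ m ih =>
    rw [pow_succ]
    have := ih.mul h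
    convert this using 1
    push_cast; ring

theorem zpow {z : CAField n} {w : ℤ} (h : HasOrd i z w) (m : ℤ) :
    HasOrd i (z ^ m) (m * w) := by
  obtain ⟨m, rfl | rfl⟩ := m.eq_nat_or_neg
  · simpa using h.pow m
  · simpa using (h.pow m).inv

theorem prod {ι : Type*} (s : Finset ι) {f : ι → CAField n} {w : ι → ℤ}
    (h : ∀ j, HasOrd i (f j) (w j)) : HasOrd i (∏ j ∈ s, f j) (∑ j ∈ s, w j) := by
  classical
  induction s using Finset.induction_on with
  | empty => simpa using one
  | insert a s ha ih =>
    rw [Finset.prod_insert ha, Finset.sum_insert ha]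
    exact (h a).mul ih

theorem uVar_self : HasOrd i (uVar n i) 1 := ⟨1, 1, by simp, by simp, by simp⟩

theorem uVar_other {j : Fin n} (h : j ≠ i) : HasOrd i (uVar n j) 0 :=
  ⟨X j, 1, by simp [ePt, h], by simp, by simp [uVar]⟩

theorem uVar_ite (j : Fin n) : HasOrd i (uVar n j) (if j = i then 1 else 0) := by
  split_ifs with h
  · subst h; exact uVar_self
  · exact uVar_other h

theorem eq_zero_of_poly {f : MvPolynomial (Fin n) ℚ} (hf : ¬ X i ∣ f) {m : ℤ}
    (h : HasOrd i (algebraMap (MvPolynomial (Fin n) ℚ) (CAField n) f) m) : m = 0 := by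
  obtain ⟨P, Q, hP, hQ, h⟩ := h
  have hQ0 := algMap_ne_zero_of_eval hQ
  have hinj : Function.Injective (algebraMap (MvPolynomial (Fin n) ℚ) (CAField n)) :=
    FaithfulSMul.algebraMap_injective _ _
  have hu := uVar_ne_zero i
  obtain ⟨k, rfl | rfl⟩ := m.eq_nat_or_neg
  · rcases Nat.eq_zero_or_pos k with rfl | hk
    · rfl
    exfalso
    rw [zpow_natCast] at h
    have h2 : f * Q = X i ^ k * P := by
      apply hinj
      simp only [map_mul, map_pow]
      rw [h]
      change _ = uVar n i ^ k * _
      field_simp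
    have h3 : X i ∣ f * Q := by
      rw [h2]
      exact (dvd_pow_self _ hk.ne').mul_right _
    rcases MvPolynomial.X_dvd_mul_iff.mp h3 with h4 | ⟨R, rfl⟩
    · exact hf h4
    · simp [ePt] at hQ
  · rcases Nat.eq_zero_or_pos k with rfl | hk
    · rfl
    exfalso
    rw [_root_.zpow_neg, zpow_natCast] at h
    have h2 : X i ^ k * (f * Q) = P := by
      apply hinj
      simp only [map_mul, map_pow]
      rw [h]
      change uVar n i ^ k * _ = _
      field_simp
    rw [← h2] at hP
    simp [ePt, hk.ne'] at hP

theorem unique {z : CAField n} {w w' : ℤ} (h : HasOrd i z w) (h' : HasOrd i z w') : w = w' := by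
  have h1 := h.div h'
  rw [div_self h.ne_zero, ← map_one (algebraMap (MvPolynomial (Fin n) ℚ) (CAField n))] at h1
  have := eq_zero_of_poly (f := 1) (fun ⟨R, hR⟩ => by
    have := congrArg (eval (ePt i)) hR
    simp [ePt] at this) h1
  omega

end HasOrd

theorem IsDenomVec.ord {n : ℕ} {y : CAField n} {d : Fin n → ℤ} (hd : IsDenomVec (uVar n) y d)
    {i : Fin n} {w : ℤ} (h : HasOrd i y w) : w = - d i := by
  obtain ⟨f, hf, hy⟩ := hd
  have h1 : HasOrd i (∏ j, uVar n j ^ d j) (∑ j, d j * (if j = i then 1 else 0)) :=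
    HasOrd.prod _ (fun j => (HasOrd.uVar_ite j).zpow (d j))
  have h2 : ∑ j, d j * (if j = i then (1 : ℤ) else 0) = d i := by simp
  rw [h2] at h1
  have h3 : MvPolynomial.aeval (uVar n) f =
      algebraMap (MvPolynomial (Fin n) ℚ) (CAField n) (MvPolynomial.map (Int.castRingHom ℚ) f) := by
    rw [← MvPolynomial.aeval_X_left_apply (MvPolynomial.map (Int.castRingHom ℚ) f)]
    rw [← MvPolynomial.aeval_algebraMap_apply]
    change _ = MvPolynomial.aeval (uVar n) _
    rw [MvPolynomial.aeval_def, MvPolynomial.aeval_def, MvPolynomial.eval₂_map]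
    congr 1
    exact RingHom.ext_int _ _
  have h4 := h.mul h1
  rw [hy, div_mul_cancel₀ _ h1.ne_zero, h3] at h4
  have := HasOrd.eq_zero_of_poly ?_ h4
  · omega
  · intro hdvd
    apply hf i
    rw [MvPolynomial.X_dvd_iff_modMonomial_eq_zero] at hdvd ⊢
    ext m
    by_cases hm : Finsupp.single i 1 ≤ m
    · simp [coeff_modMonomial_of_le _ hm]
    · have := congrArg (coeff m) hdvd
      rw [coeff_modMonomial_of_not_le _ hm, coeff_map] at this
      rw [coeff_modMonomial_of_not_le _ hm]
      simpa using this
/-! ### Part 2: symmetric triangulations of the `2N`-gon -/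

/-- Chords of the `2N`-gon up to the central symmetry, encoded by pairs of integers. -/
def chSet (N : ℤ) : Setoid (ℤ × ℤ) where
  r x y := ∃ m : ℤ, (y.1 = x.1 + m * N ∧ y.2 = x.2 + m * N) ∨
    (y.1 = x.2 + m * N ∧ y.2 = x.1 + m * N + 2 * N)
  iseqv := by
    refine ⟨fun x => ⟨0, by simp⟩, ?_, ?_⟩
    · rintro x y ⟨m, ⟨h1, h2⟩ | ⟨h1, h2⟩⟩
      · exact ⟨-m, Or.inl ⟨by rw [h1]; ring, by rw [h2]; ring⟩⟩
      · exact ⟨-m - 2, Or.inr ⟨by rw [h2]; ring, by rw [h1]; ring⟩⟩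
    · rintro x y z ⟨m, ⟨h1, h2⟩ | ⟨h1, h2⟩⟩ ⟨m', ⟨h3, h4⟩ | ⟨h3, h4⟩⟩
      · exact ⟨m + m', Or.inl ⟨by rw [h3, h1]; ring, by rw [h4, h2]; ring⟩⟩
      · exact ⟨m + m', Or.inr ⟨by rw [h3, h2]; ring, by rw [h4, h1]; ring⟩⟩
      · exact ⟨m + m', Or.inr ⟨by rw [h3, h1]; ring, by rw [h4, h2]; ring⟩⟩
      · exact ⟨m + m' + 2, Or.inl ⟨by rw [h3, h2]; ring, by rw [h4, h1]; ring⟩⟩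

/-- Classes of chords. -/
abbrev Cl (N : ℤ) : Type := Quotient (chSet N)

/-- The class of the chord `(a, b)`. -/
def cl (N a b : ℤ) : Cl N := Quotient.mk (chSet N) (a, b)

theorem cl_exact {N a b a' b' : ℤ} (h : cl N a b = cl N a' b') :
    ∃ m : ℤ, (a' = a + m * N ∧ b' = b + m * N) ∨ (a' = b + m * N ∧ b' = a + m * N + 2 * N) :=
  Quotient.exact h

theorem cl_shift (N a b m : ℤ) : cl N (a + m * N) (b + m * N) = cl N a b :=
  (Quotient.sound ⟨m, Or.inl ⟨rfl, rfl⟩⟩ : cl N a b = _).symm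

theorem cl_rot (N a b : ℤ) : cl N b (a + 2 * N) = cl N a b :=
  (Quotient.sound ⟨0, Or.inr ⟨by simp, by simp⟩⟩ : cl N a b = _).symm

theorem cl_shift1 (N a b : ℤ) : cl N (a + N) (b + N) = cl N a b := by
  simpa using cl_shift N a b 1

theorem cl_shift2 (N a b : ℤ) : cl N (a + 2 * N) (b + 2 * N) = cl N a b := cl_shift N a b 2

theorem mult_cases {N : ℤ} (hN : 0 < N) (m : ℤ) : m * N ≤ -3 * N ∨ m * N = -2 * N ∨ m * N = -N ∨
    m * N = 0 ∨ m * N = N ∨ m * N = 2 * N ∨ 3 * N ≤ m * N := by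
  have : m ≤ -3 ∨ m = -2 ∨ m = -1 ∨ m = 0 ∨ m = 1 ∨ m = 2 ∨ 3 ≤ m := by omega
  rcases this with h | rfl | rfl | rfl | rfl | rfl | h
  · left; nlinarith
  · simp
  · simp
  · simp
  · simp
  · simp
  · iterate 6 right
    nlinarith

theorem cl_cases {N a b a' b' : ℤ} (hN : 0 < N) (h : cl N a b = cl N a' b') :
    ∃ t : ℤ, (t ≤ -3 * N ∨ t = -2 * N ∨ t = -N ∨ t = 0 ∨ t = N ∨ t = 2 * N ∨ 3 * N ≤ t) ∧
      ((a' = a + t ∧ b' = b + t) ∨ (a' = b + t ∧ b' = a + t + 2 * N)) := by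
  obtain ⟨m, hm⟩ := cl_exact h
  exact ⟨m * N, mult_cases hN m, hm⟩

/-- The three sides of a triangle are pairwise inequivalent. -/
theorem tri_ne {N x y z : ℤ} (h1 : x < y) (h2 : y < z) (h3 : z < x + 2 * N) :
    cl N x y ≠ cl N y z ∧ cl N x y ≠ cl N x z ∧ cl N y z ≠ cl N x z := by
  have hN : 0 < N := by omega
  refine ⟨?_, ?_, ?_⟩ <;> intro h <;> obtain ⟨t, ht, h⟩ := cl_cases hN h <;> omega

variable {n : ℕ} {N : ℤ}

/-- Sides of the triangulation: boundary edges and labelled chords. -/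
def Ed (N : ℤ) (χ : Fin n → Cl N) (a b : ℤ) : Prop :=
  b = a + 1 ∨ b = a + 2 * N - 1 ∨ ∃ j, χ j = cl N a b

open scoped Classical in
/-- Indicator that `(a,b)` has label `i`. -/
def ind (χ : Fin n → Cl N) (i : Fin n) (a b : ℤ) : ℤ := if χ i = cl N a b then 1 else 0

theorem Ed.rot {χ : Fin n → Cl N} {a b : ℤ} (h : Ed N χ a b) : Ed N χ b (a + 2 * N) := by
  rcases h with h | h | ⟨j, h⟩
  · right; left; omega
  · left; omega
  · right; right; exact ⟨j, by rw [cl_rot, h]⟩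

theorem Ed.shift {χ : Fin n → Cl N} {a b : ℤ} (h : Ed N χ a b) (m : ℤ) :
    Ed N χ (a + m * N) (b + m * N) := by
  rcases h with h | h | ⟨j, h⟩
  · left; omega
  · right; left; omega
  · right; right; exact ⟨j, by rw [cl_shift, h]⟩

theorem Ed.shift1 {χ : Fin n → Cl N} {a b : ℤ} (h : Ed N χ a b) : Ed N χ (a + N) (b + N) := by
  simpa using h.shift 1

theorem Ed.rot' {χ : Fin n → Cl N} {a b : ℤ} (h : Ed N χ b (a + 2 * N)) : Ed N χ a b := by
  have := h.rot.shift (-2)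
  convert this using 1 <;> ring

theorem Ed.label {χ : Fin n → Cl N} {a b : ℤ} (h : Ed N χ a b) (h1 : a + 1 < b)
    (h2 : b + 1 < a + 2 * N) : ∃ j, χ j = cl N a b := by
  rcases h with h | h | h
  · omega
  · omega
  · exact h

theorem ind_congr (χ : Fin n → Cl N) (i : Fin n) {a b a' b' : ℤ} (h : cl N a b = cl N a' b') :
    ind χ i a b = ind χ i a' b' := by unfold ind; rw [h]

theorem ind_pos {χ : Fin n → Cl N} {i : Fin n} {a b : ℤ} (h : χ i = cl N a b) :
    ind χ i a b = 1 := if_pos h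

theorem ind_neg {χ : Fin n → Cl N} {i : Fin n} {a b : ℤ} (h : χ i ≠ cl N a b) :
    ind χ i a b = 0 := if_neg h

theorem ind_01 (χ : Fin n → Cl N) (i : Fin n) (a b : ℤ) :
    (ind χ i a b = 0 ∧ χ i ≠ cl N a b) ∨ (ind χ i a b = 1 ∧ χ i = cl N a b) := by
  unfold ind; split_ifs with h <;> simp [h]

/-- The quadrilateral around the chord `(a,c)` with label `j`. -/
structure Quad (N : ℤ) (B : Matrix (Fin n) (Fin n) ℤ) (χ : Fin n → Cl N) (j : Fin n)
    (a b c d : ℤ) : Prop where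
  h1 : a < b
  h2 : b < c
  h3 : c < d
  h4 : d < a + 2 * N
  hj : χ j = cl N a c
  e1 : Ed N χ a b
  e2 : Ed N χ b c
  e3 : Ed N χ c d
  e4 : Ed N χ d (a + 2 * N)
  col : ∀ i, B i j = ind χ i a b + ind χ i c d - ind χ i b c - ind χ i d (a + 2 * N)

/-- The matrix `B` is the exchange matrix of the symmetric triangulation `χ`. -/
structure Model (N : ℤ) (B : Matrix (Fin n) (Fin n) ℤ) (χ : Fin n → Cl N) : Prop where
  inj : Function.Injective χ
  nc : ∀ a b c d, a < c → c < b → b < d → d < a + 2 * N → Ed N χ a b → Ed N χ c d → False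
  diam : ∃ c j, χ j = cl N c (c + N)
  quad : ∀ j, ∃ a b c d, Quad N B χ j a b c d

variable {B : Matrix (Fin n) (Fin n) ℤ} {χ : Fin n → Cl N}

theorem Quad.rot {j : Fin n} {a b c d : ℤ} (q : Quad N B χ j a b c d) :
    Quad N B χ j c d (a + 2 * N) (b + 2 * N) where
  h1 := q.h3
  h2 := q.h4
  h3 := by have := q.h1; omega
  h4 := by have := q.h2; omega
  hj := by rw [cl_rot, q.hj]
  e1 := q.e3
  e2 := q.e4
  e3 := q.e1.shift 2
  e4 := q.e2.shift 2
  col i := by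
    rw [q.col, ind_congr χ i (cl_shift2 N a b), ind_congr χ i (cl_shift2 N b c)]; ring

theorem Quad.shift {j : Fin n} {a b c d : ℤ} (q : Quad N B χ j a b c d) (m : ℤ) :
    Quad N B χ j (a + m * N) (b + m * N) (c + m * N) (d + m * N) where
  h1 := by have := q.h1; omega
  h2 := by have := q.h2; omega
  h3 := by have := q.h3; omega
  h4 := by have := q.h4; omega
  hj := by rw [cl_shift, q.hj]
  e1 := q.e1.shift m
  e2 := q.e2.shift m
  e3 := q.e3.shift m
  e4 := by convert q.e4.shift m using 1; ring
  col i := by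
    have : cl N (d + m * N) (a + m * N + 2 * N) = cl N d (a + 2 * N) := by
      rw [← cl_shift N d (a + 2 * N) m]; congr 1; ring
    rw [q.col, ind_congr χ i (cl_shift N a b m), ind_congr χ i (cl_shift N b c m),
      ind_congr χ i (cl_shift N c d m), ind_congr χ i this]

theorem Model.quadAt (M : Model N B χ) {j : Fin n} {a c : ℤ} (h : χ j = cl N a c) :
    ∃ b d, Quad N B χ j a b c d := by
  obtain ⟨a', b, c', d, q⟩ := M.quad j
  obtain ⟨m, ⟨rfl, rfl⟩ | ⟨rfl, rfl⟩⟩ := cl_exact (q.hj.symm.trans h)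
  · exact ⟨_, _, q.shift m⟩
  · have := q.rot.shift m
    refine ⟨d + m * N, b + 2 * N + m * N, ?_⟩
    convert this using 1; ring

/-- The triangle on the outer side of an edge is unique. -/
theorem Model.triUniq (M : Model N B χ) {a b c c' : ℤ} (h0 : a < b) (h1 : b < c)
    (h2 : c < a + 2 * N) (h1' : b < c') (h2' : c' < a + 2 * N)
    (e1 : Ed N χ b c) (e2 : Ed N χ c (a + 2 * N))
    (e1' : Ed N χ b c') (e2' : Ed N χ c' (a + 2 * N)) : c = c' := by
  rcases lt_trichotomy c c' with h | h | h
  · exact (M.nc a c b c' h0 h1 h h2' e2.rot' e1').elim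
  · exact h
  · exact (M.nc a c' b c h0 h1' h h2 e2'.rot' e1).elim

/-- The triangle on the inner side of an edge is unique. -/
theorem Model.triUniq' (M : Model N B χ) {a b c c' : ℤ} (h0 : c < a + 2 * N) (h1 : a < b)
    (h2 : b < c) (h1' : a < c') (h2' : c' < c)
    (e1 : Ed N χ a b) (e2 : Ed N χ b c)
    (e1' : Ed N χ a c') (e2' : Ed N χ c' c) : b = c' := by
  rcases lt_trichotomy b c' with h | h | h
  · exact (M.nc a c' b c h1 h h2' h0 e1' e2).elim
  · exact h
  · exact (M.nc a b c' c h1' h h2 h0 e1 e2').elim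

theorem Model.quadUniq (M : Model N B χ) {j : Fin n} {a b c d b' d' : ℤ}
    (q : Quad N B χ j a b c d) (q' : Quad N B χ j a b' c d') : b = b' ∧ d = d' := by
  have := q.h1; have := q.h2; have := q.h3; have := q.h4
  have := q'.h1; have := q'.h2; have := q'.h3; have := q'.h4
  exact ⟨M.triUniq' (by omega) (by omega) (by omega) (by omega) (by omega) q.e1 q.e2 q'.e1 q'.e2,
    M.triUniq (a := a) (b := c) (by omega) (by omega) (by omega) (by omega) (by omega)
      q.e3 q.e4 q'.e3 q'.e4⟩

theorem Model.flipUniq (M : Model N B χ) {j : Fin n} {a b c d a' b' c' d' : ℤ}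
    (q : Quad N B χ j a b c d) (q' : Quad N B χ j a' b' c' d') : cl N b d = cl N b' d' := by
  obtain ⟨m, ⟨rfl, rfl⟩ | ⟨rfl, rfl⟩⟩ := cl_exact (q.hj.symm.trans q'.hj)
  · obtain ⟨rfl, rfl⟩ := M.quadUniq (q.shift m) q'
    rw [cl_shift]
  · have := q.rot.shift m
    rw [show a + 2 * N + m * N = a + m * N + 2 * N by ring] at this
    obtain ⟨rfl, rfl⟩ := M.quadUniq this q'
    rw [cl_shift, cl_rot]

theorem Quad.posneg {j : Fin n} {a b c d : ℤ} (q : Quad N B χ j a b c d) (i : Fin n) :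
    (ind χ i a b + ind χ i c d = 0 ∨ ind χ i b c + ind χ i d (a + 2 * N) = 0) := by
  have h1 := q.h1; have h2 := q.h2; have h3 := q.h3; have h4 := q.h4
  have t1 := (tri_ne (N := N) h1 h2 (by omega)).1
  have t2 := (tri_ne (N := N) h2 h3 (by omega)).1
  have t3 := (tri_ne (N := N) h3 h4 (by omega)).1
  have t4 := (tri_ne (N := N) (x := d) (y := a + 2 * N) (z := b + 2 * N)
    (by omega) (by omega) (by omega)).1
  rw [cl_shift2] at t4
  rcases ind_01 χ i a b with ⟨p1, r1⟩ | ⟨p1, r1⟩ <;> rcases ind_01 χ i b c with ⟨p2, r2⟩ | ⟨p2, r2⟩ <;>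
    rcases ind_01 χ i c d with ⟨p3, r3⟩ | ⟨p3, r3⟩ <;>
    rcases ind_01 χ i d (a + 2 * N) with ⟨p4, r4⟩ | ⟨p4, r4⟩ <;> simp_all

theorem ind_nonneg (χ : Fin n → Cl N) (i : Fin n) (a b : ℤ) : 0 ≤ ind χ i a b := by
  unfold ind; split_ifs <;> norm_num

/-- Positive and negative parts of a column. -/
theorem Quad.parts {j : Fin n} {a b c d : ℤ} (q : Quad N B χ j a b c d) (i : Fin n) :
    max (B i j) 0 = ind χ i a b + ind χ i c d ∧
    max (-B i j) 0 = ind χ i b c + ind χ i d (a + 2 * N) := by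
  have h := q.col i
  have p1 := ind_nonneg χ i a b; have p2 := ind_nonneg χ i b c
  have p3 := ind_nonneg χ i c d; have p4 := ind_nonneg χ i d (a + 2 * N)
  rcases q.posneg i with h' | h'
  · constructor
    · rw [max_eq_right] <;> omega
    · rw [max_eq_left] <;> omega
  · constructor
    · rw [max_eq_left] <;> omega
    · rw [max_eq_right] <;> omega

theorem Quad.diag {j : Fin n} {a b c d : ℤ} (q : Quad N B χ j a b c d) : B j j = 0 := by
  have h1 := q.h1; have h2 := q.h2; have h3 := q.h3; have h4 := q.h4
  have t1 := tri_ne (N := N) h1 h2 (by omega)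
  have t2 := tri_ne (N := N) (x := c) (y := d) (z := a + 2 * N) h3 h4 (by omega)
  rw [cl_rot N a c] at t2
  rw [q.col, ind_neg, ind_neg, ind_neg, ind_neg]
  · ring
  all_goals rw [q.hj]
  · exact t2.2.2.symm
  · exact t1.2.2.symm
  · exact t2.2.1.symm
  · exact t1.2.1.symm
/-! ### Part 3: flips are mutations -/

theorem mutMat_mutMat (k : Fin n) (B : Matrix (Fin n) (Fin n) ℤ) :
    mutMat k (mutMat k B) = B := by
  ext i j
  unfold mutMat
  by_cases hi : i = k
  · simp [hi]
  by_cases hj : j = k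
  · simp [hj]
  simp [hi, hj]

theorem flip_ne_edge (M : Model N B χ) {k : Fin n} {a b c d : ℤ} (q : Quad N B χ k a b c d)
    {x y : ℤ} (h : Ed N χ x y) : cl N b d ≠ cl N x y := by
  intro hxy
  have h1 := q.h1; have h2 := q.h2; have h3 := q.h3; have h4 := q.h4
  have hb : Ed N χ b d := by
    rcases h with h | h | ⟨j, h⟩
    · obtain ⟨t, ht, hh⟩ := cl_cases (by omega) hxy
      omega
    · obtain ⟨t, ht, hh⟩ := cl_cases (by omega) hxy
      omega
    · exact Or.inr (Or.inr ⟨j, by rw [h, hxy]⟩)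
  exact M.nc a c b d h1 h2 h3 h4 (Or.inr (Or.inr ⟨k, q.hj⟩)) hb

theorem flip_ne_label (M : Model N B χ) {k : Fin n} {a b c d : ℤ} (q : Quad N B χ k a b c d)
    (j : Fin n) : χ j ≠ cl N b d := by
  intro h
  exact flip_ne_edge M q (x := b) (y := d) (Or.inr (Or.inr ⟨j, h⟩)) rfl

/-- An edge not labelled `k` survives the flip at `k`. -/
theorem Ed.upd {k : Fin n} {γ : Cl N} {x y : ℤ} (h : Ed N χ x y) (hk : χ k ≠ cl N x y) :
    Ed N (Function.update χ k γ) x y := by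
  rcases h with h | h | ⟨j, h⟩
  · exact Or.inl h
  · exact Or.inr (Or.inl h)
  · refine Or.inr (Or.inr ⟨j, ?_⟩)
    rw [Function.update_of_ne, h]
    rintro rfl
    exact hk h

theorem Ed.new {k : Fin n} {γ : Cl N} {x y : ℤ} (h : γ = cl N x y) :
    Ed N (Function.update χ k γ) x y :=
  Or.inr (Or.inr ⟨k, by rw [Function.update_self, h]⟩)

theorem Ed.upd_cases {k : Fin n} {γ : Cl N} (hinj : Function.Injective χ)
    {a c : ℤ} (hk : χ k = cl N a c) (hac : a + 1 < c) (hac' : c + 1 < a + 2 * N) {x y : ℤ}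
    (h : Ed N (Function.update χ k γ) x y) : (Ed N χ x y ∧ χ k ≠ cl N x y) ∨ γ = cl N x y := by
  rcases h with h | h | ⟨j, h⟩
  · refine Or.inl ⟨Or.inl h, fun h' => ?_⟩
    obtain ⟨t, ht, hh⟩ := cl_cases (by omega) (hk.symm.trans h')
    omega
  · refine Or.inl ⟨Or.inr (Or.inl h), fun h' => ?_⟩
    obtain ⟨t, ht, hh⟩ := cl_cases (by omega) (hk.symm.trans h')
    omega
  · by_cases hj : j = k
    · subst hj
      rw [Function.update_self] at h
      exact Or.inr h
    · rw [Function.update_of_ne hj] at h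
      refine Or.inl ⟨Or.inr (Or.inr ⟨j, h⟩), fun h' => hj (hinj (h.trans h'.symm))⟩

theorem ind_upd_ne {k i : Fin n} {γ : Cl N} (h : i ≠ k) (x y : ℤ) :
    ind (Function.update χ k γ) i x y = ind χ i x y := by
  unfold ind; rw [Function.update_of_ne h]

/-- The new chord crosses no old edge other than the flipped chord. -/
theorem flip_nc_aux (M : Model N B χ) {k : Fin n} {a b c d : ℤ} (q : Quad N B χ k a b c d)
    {z w : ℤ} (h : Ed N χ z w) (hk : χ k ≠ cl N z w) (h1 : b < z) (h2 : z < d) (h3 : d < w)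
    (h4 : w < b + 2 * N) : False := by
  have g1 := q.h1; have g2 := q.h2; have g3 := q.h3; have g4 := q.h4
  rcases lt_trichotomy z c with hz | rfl | hz
  · exact M.nc b c z w h1 hz (by omega) h4 q.e2 h
  · rcases lt_trichotomy w (a + 2 * N) with hw | rfl | hw
    · exact M.nc z w d (a + 2 * N) h2 h3 hw (by omega) h q.e4
    · rw [cl_rot] at hk
      exact hk q.hj
    · exact M.nc z w (a + 2 * N) (b + 2 * N) (by omega) hw h4 (by omega) h (q.e1.shift 2)
  · exact M.nc c d z w hz h2 h3 (by omega) q.e3 h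

theorem flip_nc_aux2 (M : Model N B χ) {k : Fin n} {a b c d : ℤ} (q : Quad N B χ k a b c d)
    {x y z w : ℤ} (hxy : cl N b d = cl N x y)
    (h : Ed N χ z w) (hk : χ k ≠ cl N z w) (h1 : x < z) (h2 : z < y) (h3 : y < w)
    (h4 : w < x + 2 * N) : False := by
  obtain ⟨m, ⟨rfl, rfl⟩ | ⟨rfl, rfl⟩⟩ := cl_exact hxy
  · have hs := h.shift (-m)
    refine flip_nc_aux M q hs (by rwa [cl_shift]) ?_ ?_ ?_ ?_ <;> rw [neg_mul] <;> omega
  · have hs := h.shift (-m)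
    refine flip_nc_aux M q.rot hs (by rwa [cl_shift]) ?_ ?_ ?_ ?_ <;> rw [neg_mul] <;> omega

theorem Model.flip_nc (M : Model N B χ) {k : Fin n} {a b c d : ℤ} (q : Quad N B χ k a b c d)
    (x y z w : ℤ) (h1 : x < z) (h2 : z < y) (h3 : y < w) (h4 : w < x + 2 * N)
    (e : Ed N (Function.update χ k (cl N b d)) x y)
    (e' : Ed N (Function.update χ k (cl N b d)) z w) : False := by
  have g1 := q.h1; have g2 := q.h2; have g3 := q.h3; have g4 := q.h4
  rcases Ed.upd_cases M.inj q.hj (by omega) (by omega) e with ⟨e, ek⟩ | e <;>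
    rcases Ed.upd_cases M.inj q.hj (by omega) (by omega) e' with ⟨e', ek'⟩ | e'
  · exact M.nc x y z w h1 h2 h3 h4 e e'
  · exact flip_nc_aux2 M q e' e.rot (by rwa [cl_rot]) h2 h3 h4 (by omega)
  · exact flip_nc_aux2 M q e e' ek' h1 h2 h3 h4
  · obtain ⟨t, ht, hh⟩ := cl_cases (by omega) (e.symm.trans e')
    omega

theorem mutMat_ne {k i j : Fin n} (hi : i ≠ k) (hj : j ≠ k) :
    mutMat k B i j = B i j + (B i k).sign * max (B i k * B k j) 0 := by
  simp [mutMat, hi, hj]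

theorem mutMat_row {k j : Fin n} : mutMat k B k j = - B k j := by
  simp [mutMat]

theorem mutMat_col {k i : Fin n} : mutMat k B i k = - B i k := by
  simp [mutMat]

theorem sign_mul_max_pos (x : ℤ) {κ : ℤ} (h : 0 ≤ κ) : x.sign * max (x * κ) 0 = κ * max x 0 := by
  rcases lt_trichotomy x 0 with hx | rfl | hx
  · rw [max_eq_right (by nlinarith), max_eq_right hx.le]; simp
  · simp
  · rw [Int.sign_eq_one_of_pos hx, max_eq_left (by positivity), max_eq_left hx.le]; ring

theorem sign_mul_max_neg (x : ℤ) {κ : ℤ} (h : 0 ≤ κ) :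
    x.sign * max (x * -κ) 0 = - (κ * max (-x) 0) := by
  have := sign_mul_max_pos (-x) h
  rw [Int.sign_neg, neg_mul_comm] at this
  rw [← this]; ring_nf

/-- The quadrilateral of an unaffected label. -/
theorem flip_quad0 (M : Model N B χ) {k : Fin n} {γ : Cl N}
    (hE : ∀ x y, Ed N χ x y → γ ≠ cl N x y) {j : Fin n} (hj : j ≠ k)
    {p q r s : ℤ} (Q : Quad N B χ j p q r s) (n1 : χ k ≠ cl N p q) (n2 : χ k ≠ cl N q r)
    (n3 : χ k ≠ cl N r s) (n4 : χ k ≠ cl N s (p + 2 * N)) :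
    Quad N (mutMat k B) (Function.update χ k γ) j p q r s where
  h1 := Q.h1
  h2 := Q.h2
  h3 := Q.h3
  h4 := Q.h4
  hj := by rw [Function.update_of_ne hj, Q.hj]
  e1 := Q.e1.upd n1
  e2 := Q.e2.upd n2
  e3 := Q.e3.upd n3
  e4 := Q.e4.upd n4
  col i := by
    have hk : B k j = 0 := by
      rw [Q.col, ind_neg n1, ind_neg n2, ind_neg n3, ind_neg n4]; ring
    by_cases hi : i = k
    · subst hi
      rw [mutMat_row, hk, ind_neg, ind_neg, ind_neg, ind_neg]
      · ring
      all_goals rw [Function.update_self]; apply hE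
      · exact Q.e4
      · exact Q.e2
      · exact Q.e3
      · exact Q.e1
    · rw [mutMat_ne hi hj, hk]
      simp only [ind_upd_ne hi]
      rw [← Q.col]; simp

theorem flip_quad1 (M : Model N B χ) {k : Fin n} {γ : Cl N}
    (hE : ∀ x y, Ed N χ x y → γ ≠ cl N x y)
    (hγ : ∀ a b c d, Quad N B χ k a b c d → γ = cl N b d) {j : Fin n} (hj : j ≠ k)
    {p q r s : ℤ} (Q : Quad N B χ j p q r s) (hk : χ k = cl N p q) :
    ∃ a b c d, Quad N (mutMat k B) (Function.update χ k γ) j a b c d := by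
  have h1 := Q.h1; have h2 := Q.h2; have h3 := Q.h3; have h4 := Q.h4
  have hN : 0 < N := by omega
  obtain ⟨e, f, K⟩ := M.quadAt hk
  have g1 := K.h1; have g2 := K.h2; have g3 := K.h3; have g4 := K.h4
  have hpr : Ed N χ p r := Or.inr (Or.inr ⟨j, Q.hj⟩)
  obtain rfl : f = r := M.triUniq (a := p) (b := q) h1 g3 g4 h2 (by omega) K.e3 K.e4 Q.e2 hpr.rot
  have hγ' : γ = cl N e f := hγ _ _ _ _ K
  have hlab : ∀ i, χ i ≠ cl N e f := flip_ne_label M K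
  -- distinctness
  have t1 := tri_ne (N := N) h1 h2 (by omega)
  have t2 := tri_ne (N := N) g1 g2 (by omega)
  have t4 := (tri_ne (N := N) (x := s) (y := p + 2 * N) (z := q + 2 * N) (by omega) (by omega)
    (by omega)).1
  rw [cl_shift2] at t4
  have ipe : Ed N (Function.update χ k γ) p e := K.e1.upd (by rw [hk]; exact t2.2.1.symm)
  have kqr : ind χ k q f = 0 := ind_neg (by rw [hk]; exact t1.1)
  have ksp : ind χ k s (p + 2 * N) = 0 := ind_neg (by rw [hk]; exact t4.symm)
  by_cases hrs : χ k = cl N f s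
  · obtain ⟨hf, hs⟩ : f = p + N ∧ s = q + N := by
      obtain ⟨t, ht, hh⟩ := cl_cases (by omega) (hk.symm.trans hrs)
      omega
    have c1 : cl N f (e + N) = cl N p e := by rw [hf, cl_shift1]
    have c2 : cl N (e + N) (p + 2 * N) = cl N e f := by
      rw [hf, ← cl_shift1 N e]; congr 1; ring
    have c3 : cl N s (p + 2 * N) = cl N q f := by
      rw [hf, hs, ← cl_shift1 N q]; congr 1; ring
    refine ⟨p, e, f, e + N, g1, by omega, by omega, by omega, ?_, ipe, Ed.new hγ', ?_,
      Ed.new (by rw [c2, hγ']), ?_⟩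
    · rw [Function.update_of_ne hj, Q.hj]
    · have := ipe.shift1
      rwa [← hf] at this
    · intro i
      rw [ind_congr _ i c1, ind_congr _ i c2]
      have hkj : B k j = 2 := by
        rw [Q.col, ind_pos hk, ind_pos hrs, kqr, ksp]; ring
      by_cases hi : i = k
      · subst hi
        rw [mutMat_row, hkj, ind_neg (a := p), ind_pos (a := e)]
        · ring
        · rw [Function.update_self, hγ']
        · rw [Function.update_self]; exact hE _ _ K.e1
      · rw [mutMat_ne hi hj, hkj, sign_mul_max_pos _ (by norm_num), (K.parts i).1, Q.col i]
        simp only [ind_upd_ne hi]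
        rw [ind_neg (hlab i), ind_congr χ i c3, ind_neg (a := p) (b := q), ind_neg (a := f) (b := s)]
        · ring
        · rw [← hrs]; exact fun h => hi (M.inj h)
        · rw [← hk]; exact fun h => hi (M.inj h)
  · refine ⟨p, e, f, s, g1, by omega, h3, h4, ?_, ipe, Ed.new hγ', Q.e3.upd hrs,
      Q.e4.upd (by rw [hk]; exact t4.symm), ?_⟩
    · rw [Function.update_of_ne hj, Q.hj]
    · intro i
      have hkj : B k j = 1 := by
        rw [Q.col, ind_pos hk, ind_neg hrs, kqr, ksp]; ring
      by_cases hi : i = k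
      · subst hi
        rw [mutMat_row, hkj, ind_neg (a := p), ind_neg (a := f), ind_pos (a := e),
          ind_neg (a := s)]
        · ring
        all_goals rw [Function.update_self]
        · exact hE _ _ Q.e4
        · exact hγ'
        · exact hE _ _ Q.e3
        · exact hE _ _ K.e1
      · rw [mutMat_ne hi hj, hkj, sign_mul_max_pos _ (by norm_num), (K.parts i).1, Q.col i]
        simp only [ind_upd_ne hi]
        rw [ind_neg (hlab i), ind_neg (a := p) (b := q)]
        · ring
        · rw [← hk]; exact fun h => hi (M.inj h)

theorem flip_quad2 (M : Model N B χ) {k : Fin n} {γ : Cl N}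
    (hE : ∀ x y, Ed N χ x y → γ ≠ cl N x y)
    (hγ : ∀ a b c d, Quad N B χ k a b c d → γ = cl N b d) {j : Fin n} (hj : j ≠ k)
    {p q r s : ℤ} (Q : Quad N B χ j p q r s) (hk : χ k = cl N q r) :
    ∃ a b c d, Quad N (mutMat k B) (Function.update χ k γ) j a b c d := by
  have h1 := Q.h1; have h2 := Q.h2; have h3 := Q.h3; have h4 := Q.h4
  have hN : 0 < N := by omega
  obtain ⟨e, f, K⟩ := M.quadAt hk
  have g1 := K.h1; have g2 := K.h2; have g3 := K.h3; have g4 := K.h4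
  have hpr : Ed N χ p r := Or.inr (Or.inr ⟨j, Q.hj⟩)
  obtain rfl : f = p + 2 * N := M.triUniq (a := q) (b := r) h2 g3 g4 (by omega) (by omega)
    K.e3 K.e4 hpr.rot (Q.e1.shift 2)
  have hγ' : γ = cl N p e := by rw [hγ _ _ _ _ K, cl_rot]
  have hlab : ∀ i, χ i ≠ cl N p e := fun i => by
    have := flip_ne_label M K i
    rwa [cl_rot] at this
  have t1 := tri_ne (N := N) h1 h2 (by omega)
  have t2 := tri_ne (N := N) g1 g2 (by omega)
  have t4 := (tri_ne (N := N) h2 h3 (by omega)).1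
  have ier : Ed N (Function.update χ k γ) e r := K.e2.upd (by rw [hk]; exact t2.2.2.symm)
  have kpq : ind χ k p q = 0 := ind_neg (by rw [hk]; exact t1.1.symm)
  have krs : ind χ k r s = 0 := ind_neg (by rw [hk]; exact t4)
  have hneg : ∀ i, max (-B i k) 0 = ind χ i e r + ind χ i p q := fun i => by
    rw [(K.parts i).2, ind_congr χ i (cl_shift2 N p q)]
  by_cases hsp : χ k = cl N s (p + 2 * N)
  · obtain ⟨hr, hs⟩ : r = p + N ∧ s = q + N := by
      obtain ⟨t, ht, hh⟩ := cl_cases (by omega) (hk.symm.trans hsp)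
      omega
    have c1 : cl N r (e + N) = cl N p e := by rw [hr, cl_shift1]
    have c2 : cl N (e + N) (p + 2 * N) = cl N e r := by
      rw [hr, ← cl_shift1 N e]; congr 1; ring
    have c3 : cl N r s = cl N p q := by rw [hr, hs, cl_shift1]
    refine ⟨p, e, r, e + N, by omega, by omega, by omega, by omega, ?_, Ed.new hγ', ier,
      Ed.new (by rw [c1, hγ']), ?_, ?_⟩
    · rw [Function.update_of_ne hj, Q.hj]
    · have := ier.shift1
      rwa [hr, show p + N + N = p + 2 * N by ring] at this
    · intro i
      rw [ind_congr _ i c1, ind_congr _ i c2]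
      have hkj : B k j = -2 := by
        rw [Q.col, ind_pos hk, ind_pos hsp, kpq, krs]; ring
      by_cases hi : i = k
      · subst hi
        rw [mutMat_row, hkj, ind_neg (a := e), ind_pos (a := p)]
        · ring
        · rw [Function.update_self, hγ']
        · rw [Function.update_self]; exact hE _ _ K.e2
      · rw [mutMat_ne hi hj, hkj, sign_mul_max_neg _ (by norm_num), hneg, Q.col i]
        simp only [ind_upd_ne hi]
        rw [ind_neg (hlab i), ind_congr χ i c3, ind_neg (a := q) (b := r),
          ind_neg (a := s) (b := p + 2 * N)]
        · ring
        · rw [← hsp]; exact fun h => hi (M.inj h)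
        · rw [← hk]; exact fun h => hi (M.inj h)
  · refine ⟨p, e, r, s, by omega, g2, h3, h4, ?_, Ed.new hγ', ier, Q.e3.upd (by rw [hk]; exact t4),
      Q.e4.upd hsp, ?_⟩
    · rw [Function.update_of_ne hj, Q.hj]
    · intro i
      have hkj : B k j = -1 := by
        rw [Q.col, ind_pos hk, ind_neg hsp, kpq, krs]; ring
      by_cases hi : i = k
      · subst hi
        rw [mutMat_row, hkj, ind_neg (a := e), ind_neg (a := r), ind_pos (a := p),
          ind_neg (a := s)]
        · ring
        all_goals rw [Function.update_self]
        · exact hE _ _ Q.e4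
        · exact hγ'
        · exact hE _ _ Q.e3
        · exact hE _ _ K.e2
      · rw [mutMat_ne hi hj, hkj, sign_mul_max_neg _ (by norm_num), hneg, Q.col i]
        simp only [ind_upd_ne hi]
        rw [ind_neg (hlab i), ind_neg (a := q) (b := r)]
        · ring
        · rw [← hk]; exact fun h => hi (M.inj h)

/-- Flipping the diameter yields a diameter. -/
theorem Model.flip_diam (M : Model N B χ) {k : Fin n} {a b c d : ℤ} (q : Quad N B χ k a b c d)
    (hc : c = a + N) : d = b + N := by
  have g1 := q.h1; have g2 := q.h2; have g3 := q.h3; have g4 := q.h4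
  subst hc
  refine M.triUniq (a := a) (b := a + N) (by omega) g3 g4 (by omega) (by omega) q.e3 q.e4
    q.e1.shift1 ?_
  have := q.e2.shift1
  rwa [show a + N + N = a + 2 * N by ring] at this

theorem Model.flip (M : Model N B χ) {k : Fin n} {a b c d : ℤ} (q : Quad N B χ k a b c d) :
    Model N (mutMat k B) (Function.update χ k (cl N b d)) where
  inj := by
    intro i j hij
    by_cases hi : i = k <;> by_cases hj : j = k
    · rw [hi, hj]
    · rw [hi, Function.update_self, Function.update_of_ne hj] at hij
      exact (flip_ne_label M q j hij.symm).elim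
    · rw [hj, Function.update_self, Function.update_of_ne hi] at hij
      exact (flip_ne_label M q i hij).elim
    · rw [Function.update_of_ne hi, Function.update_of_ne hj] at hij
      exact M.inj hij
  nc x y z w h1 h2 h3 h4 e e' := M.flip_nc q x y z w h1 h2 h3 h4 e e'
  diam := by
    have g1 := q.h1; have g2 := q.h2; have g3 := q.h3; have g4 := q.h4
    obtain ⟨x, j, hx⟩ := M.diam
    by_cases hj : j = k
    · subst hj
      have hc : c = a + N := by
        obtain ⟨t, ht, hh⟩ := cl_cases (by omega) (q.hj.symm.trans hx)
        omega
      refine ⟨b, j, ?_⟩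
      rw [Function.update_self, M.flip_diam q hc]
    · exact ⟨x, j, by rw [Function.update_of_ne hj, hx]⟩
  quad j := by
    by_cases hj : j = k
    · subst hj
      have g1 := q.h1; have g2 := q.h2; have g3 := q.h3; have g4 := q.h4
      have t1 := tri_ne (N := N) g1 g2 (by omega)
      have t2 := tri_ne (N := N) (x := c) (y := d) (z := a + 2 * N) g3 g4 (by omega)
      rw [cl_rot N a c] at t2
      have n1 : χ j ≠ cl N a b := by rw [q.hj]; exact t1.2.1.symm
      have n2 : χ j ≠ cl N b c := by rw [q.hj]; exact t1.2.2.symm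
      have n3 : χ j ≠ cl N c d := by rw [q.hj]; exact t2.2.1.symm
      have n4 : χ j ≠ cl N d (a + 2 * N) := by rw [q.hj]; exact t2.2.2.symm
      refine ⟨b, c, d, a + 2 * N, g2, g3, g4, by omega, by rw [Function.update_self],
        q.e2.upd n2, q.e3.upd n3, q.e4.upd n4, (q.e1.upd n1).shift 2, ?_⟩
      intro i
      rw [ind_congr _ i (cl_shift2 N a b), mutMat_col]
      by_cases hi : i = j
      · subst hi
        rw [q.diag, ind_neg, ind_neg, ind_neg, ind_neg]
        · ring
        all_goals rw [Function.update_self]; apply flip_ne_edge M q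
        · exact q.e1
        · exact q.e3
        · exact q.e4
        · exact q.e2
      · simp only [ind_upd_ne hi]
        rw [q.col]; ring
    · have hE : ∀ x y, Ed N χ x y → cl N b d ≠ cl N x y := fun x y h => flip_ne_edge M q h
      have hγ : ∀ a' b' c' d', Quad N B χ k a' b' c' d' → cl N b d = cl N b' d' :=
        fun _ _ _ _ q' => M.flipUniq q q'
      obtain ⟨p, u, r, s, Q⟩ := M.quad j
      by_cases n1 : χ k = cl N p u
      · exact flip_quad1 M hE hγ hj Q n1
      by_cases n2 : χ k = cl N u r
      · exact flip_quad2 M hE hγ hj Q n2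
      by_cases n3 : χ k = cl N r s
      · exact flip_quad1 M hE hγ hj Q.rot n3
      by_cases n4 : χ k = cl N s (p + 2 * N)
      · exact flip_quad2 M hE hγ hj Q.rot n4
      exact ⟨p, u, r, s, flip_quad0 M hE hj Q n1 n2 n3 n4⟩

/-! ### Part 4: lambda lengths and seeds -/

/-- Lambda lengths of chords: Ptolemy relations and normalized boundary. -/
structure IsLam (N : ℤ) (lam : Cl N → CAField n) : Prop where
  ptol : ∀ a b c d, a < b → b < c → c < d → d < a + 2 * N →
    lam (cl N a c) * lam (cl N b d) =
      lam (cl N a b) * lam (cl N c d) + lam (cl N b c) * lam (cl N d (a + 2 * N))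
  bdry : ∀ a, lam (cl N a (a + 1)) = 1

/-- A seed realized by a triangulation. -/
structure Good (N : ℤ) (lam : Cl N → CAField n)
    (s : Matrix (Fin n) (Fin n) ℤ × (Fin n → CAField n)) (χ : Fin n → Cl N) : Prop where
  M : Model N s.1 χ
  val : ∀ j, s.2 j = lam (χ j)

theorem IsLam.bdry' {lam : Cl N → CAField n} (L : IsLam N lam) (a : ℤ) :
    lam (cl N a (a + 2 * N - 1)) = 1 := by
  have := L.bdry (a - 1)
  rw [← cl_rot] at this
  convert this using 3 <;> ring

theorem Model.labelLen (M : Model N B χ) {j : Fin n} {a b : ℤ} (h : χ j = cl N a b) :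
    a + 1 < b ∧ b + 1 < a + 2 * N := by
  obtain ⟨x, y, q⟩ := M.quadAt h
  have := q.h1; have := q.h2; have := q.h3; have := q.h4
  omega

/-- Product over labels of an edge. -/
theorem IsLam.prod_ind {lam : Cl N → CAField n} (L : IsLam N lam) (M : Model N B χ) {a b : ℤ}
    (h : Ed N χ a b) : ∏ i, lam (χ i) ^ (ind χ i a b).toNat = lam (cl N a b) := by
  rcases h with h | h | ⟨j, h⟩
  · rw [h, L.bdry]
    apply Finset.prod_eq_one
    intro i _
    rw [ind_neg]
    · simp
    · intro h'
      have := M.labelLen h'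
      omega
  · rw [h, L.bdry']
    apply Finset.prod_eq_one
    intro i _
    rw [ind_neg]
    · simp
    · intro h'
      have := M.labelLen h'
      omega
  · rw [Finset.prod_eq_single j]
    · rw [ind_pos h, h]; simp
    · intro i _ hi
      rw [ind_neg]
      · simp
      · intro h'
        exact hi (M.inj (h'.trans h.symm))
    · simp

theorem IsLam.prods {lam : Cl N → CAField n} (L : IsLam N lam) (M : Model N B χ) {k : Fin n}
    {a b c d : ℤ} (q : Quad N B χ k a b c d) :
    ∏ i, lam (χ i) ^ (B i k).toNat = lam (cl N a b) * lam (cl N c d) ∧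
    ∏ i, lam (χ i) ^ (-(B i k)).toNat = lam (cl N b c) * lam (cl N d (a + 2 * N)) := by
  rw [← L.prod_ind M q.e1, ← L.prod_ind M q.e2, ← L.prod_ind M q.e3, ← L.prod_ind M q.e4,
    ← Finset.prod_mul_distrib, ← Finset.prod_mul_distrib]
  constructor
  · apply Finset.prod_congr rfl
    intro i _
    rw [← pow_add]
    congr 1
    have := (q.parts i).1
    have p1 := ind_nonneg χ i a b
    have p3 := ind_nonneg χ i c d
    omega
  · apply Finset.prod_congr rfl
    intro i _
    rw [← pow_add]
    congr 1
    have := (q.parts i).2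
    have p1 := ind_nonneg χ i b c
    have p3 := ind_nonneg χ i d (a + 2 * N)
    omega

theorem Good.mut {lam : Cl N → CAField n} (L : IsLam N lam)
    {s : Matrix (Fin n) (Fin n) ℤ × (Fin n → CAField n)} (G : Good N lam s χ) {k : Fin n}
    {a b c d : ℤ} (q : Quad N s.1 χ k a b c d) (hk : s.2 k ≠ 0) :
    Good N lam (mutSeed k s) (Function.update χ k (cl N b d)) where
  M := G.M.flip q
  val j := by
    have hs : s.2 = fun j => lam (χ j) := funext G.val
    by_cases hj : j = k
    · subst hj
      simp only [mutSeed, Function.update_self]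
      rw [div_eq_iff hk]
      simp only [hs]
      rw [(L.prods G.M q).1, (L.prods G.M q).2, q.hj, mul_comm (lam (cl N b d)),
        L.ptol a b c d q.h1 q.h2 q.h3 q.h4]
    · simp only [mutSeed, Function.update_of_ne hj]
      exact G.val j

/-- All entries have an order along `u_i`. -/
def Orded (i : Fin n) (s : Matrix (Fin n) (Fin n) ℤ × (Fin n → CAField n)) : Prop :=
  ∀ j, ∃ w, HasOrd i (s.2 j) w

theorem Orded.mut {i : Fin n} {s : Matrix (Fin n) (Fin n) ℤ × (Fin n → CAField n)}
    (h : Orded i s) (k : Fin n) : Orded i (mutSeed k s) := by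
  intro j
  by_cases hj : j = k
  · subst hj
    choose w hw using h
    simp only [mutSeed, Function.update_self]
    have h1 := HasOrd.prod (i := i) Finset.univ (fun l => (hw l).pow (s.1 l j).toNat)
    have h2 := HasOrd.prod (i := i) Finset.univ (fun l => (hw l).pow (-(s.1 l j)).toNat)
    exact ⟨_, (h1.add h2).div (hw j)⟩
  · simp only [mutSeed, Function.update_of_ne hj]
    exact h j

theorem IsSeed.orded {B₀ : Matrix (Fin n) (Fin n) ℤ}
    {s : Matrix (Fin n) (Fin n) ℤ × (Fin n → CAField n)} (h : IsSeed B₀ s) (i : Fin n) :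
    Orded i s := by
  induction h with
  | refl => exact fun j => ⟨_, HasOrd.uVar_ite j⟩
  | tail _ h2 ih =>
    obtain ⟨k, rfl⟩ := h2
    exact ih.mut k

theorem mutSeed_mutSeed {k : Fin n} {s : Matrix (Fin n) (Fin n) ℤ × (Fin n → CAField n)}
    (h0 : s.1 k k = 0) (h1 : s.2 k ≠ 0) (h2 : (mutSeed k s).2 k ≠ 0) :
    mutSeed k (mutSeed k s) = s := by
  refine Prod.ext ?_ ?_
  · exact mutMat_mutMat k s.1
  · have e1 : ∀ l, (mutSeed k s).1 l k = - s.1 l k := fun l => by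
      simp only [mutSeed]; exact mutMat_col
    have e2 : ∀ l (m : ℤ), (l = k → m = 0) → (mutSeed k s).2 l ^ m.toNat = s.2 l ^ m.toNat := by
      intro l m hm
      by_cases hl : l = k
      · simp [hm hl]
      · simp only [mutSeed, Function.update_of_ne hl]
    funext j
    by_cases hj : j = k
    · subst hj
      have e3 : (mutSeed j (mutSeed j s)).2 j = ((∏ i, (mutSeed j s).2 i ^ ((mutSeed j s).1 i j).toNat
        + ∏ i, (mutSeed j s).2 i ^ (-((mutSeed j s).1 i j)).toNat) / (mutSeed j s).2 j) := by
        rw [mutSeed]; simp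
      rw [e3, div_eq_iff h2]
      simp only [e1, neg_neg]
      have e4 : (mutSeed j s).2 j = ((∏ i, s.2 i ^ (s.1 i j).toNat
        + ∏ i, s.2 i ^ (-(s.1 i j)).toNat) / s.2 j) := by
        rw [mutSeed]; simp
      rw [e4, mul_div_cancel₀ _ h1, add_comm]
      congr 1
      · apply Finset.prod_congr rfl
        intro l _
        exact e2 l _ (by rintro rfl; exact h0)
      · apply Finset.prod_congr rfl
        intro l _
        exact e2 l _ (by rintro rfl; simpa using h0)
    · simp [mutSeed, Function.update_of_ne hj]

/-- One backward step. -/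
theorem Good.back {lam : Cl N → CAField n} (L : IsLam N lam)
    {s : Matrix (Fin n) (Fin n) ℤ × (Fin n → CAField n)} {k : Fin n}
    (G : Good N lam (mutSeed k s) χ) (h1 : s.2 k ≠ 0) (h2 : (mutSeed k s).2 k ≠ 0) :
    ∃ χ' : Fin n → Cl N, Good N lam s χ' := by
  obtain ⟨a, b, c, d, q⟩ := G.M.quad k
  have h0 : s.1 k k = 0 := by
    have := q.diag
    simp only [mutSeed, mutMat_col] at this
    omega
  have := G.mut L q h2
  rw [mutSeed_mutSeed h0 h1 h2] at this
  exact ⟨_, this⟩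

theorem Good.initial {lam : Cl N → CAField n} (L : IsLam N lam) {B₀ : Matrix (Fin n) (Fin n) ℤ}
    (i : Fin n) {s : Matrix (Fin n) (Fin n) ℤ × (Fin n → CAField n)} (hs : IsSeed B₀ s)
    (G : Good N lam s χ) : ∃ χ' : Fin n → Cl N, Good N lam (B₀, uVar n) χ' := by
  have key : ∀ t, Relation.ReflTransGen (fun a b => ∃ k, b = mutSeed k a) t s →
      Orded i t → ∃ χ' : Fin n → Cl N, Good N lam t χ' := by
    intro t ht
    induction ht using Relation.ReflTransGen.head_induction_on with
    | refl => exact fun _ => ⟨χ, G⟩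
    | head h1 _ ih =>
      obtain ⟨k, rfl⟩ := h1
      intro ho
      obtain ⟨χ', G'⟩ := ih (ho.mut k)
      exact G'.back L (ho k).choose_spec.ne_zero ((ho.mut k) k).choose_spec.ne_zero
  exact key _ hs (fun j => ⟨_, HasOrd.uVar_ite j⟩)

theorem Good.forward {lam : Cl N → CAField n} (L : IsLam N lam) {B₀ : Matrix (Fin n) (Fin n) ℤ}
    (i : Fin n) {s : Matrix (Fin n) (Fin n) ℤ × (Fin n → CAField n)} (hs : IsSeed B₀ s)
    (G : Good N lam (B₀, uVar n) χ) : ∃ χ' : Fin n → Cl N, Good N lam s χ' := by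
  induction hs with
  | refl => exact ⟨_, G⟩
  | @tail b c hb h2 ih =>
    obtain ⟨k, rfl⟩ := h2
    obtain ⟨χ', G'⟩ := ih
    obtain ⟨a, b, c, d, q⟩ := G'.M.quad k
    exact ⟨_, G'.mut L q ((IsSeed.orded hb i) k).choose_spec.ne_zero⟩

/-! ### Part 5: existence of lambda lengths -/

/-- Two by two determinant. -/
def dt {F : Type*} [Field F] (v w : F × F) : F := v.1 * w.2 - v.2 * w.1

/-- The symmetry of order four attached to a diameter. -/
def rotFun {F : Type*} [Field F] (p q w : F × F) : F × F :=
  (dt w q / dt p q * q.1 - dt p w / dt p q * p.1, dt w q / dt p q * q.2 - dt p w / dt p q * p.2)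

theorem rotFun_dt {F : Type*} [Field F] (p q w z : F × F) (h : dt p q ≠ 0) :
    dt (rotFun p q w) (rotFun p q z) = dt w z := by
  obtain ⟨D, hD⟩ : ∃ D, D = dt p q := ⟨_, rfl⟩
  simp only [rotFun, ← hD]
  rw [← hD] at h
  unfold dt at *
  field_simp
  rw [hD]
  ring

theorem rotFun_sq {F : Type*} [Field F] (p q w : F × F) (h : dt p q ≠ 0) :
    rotFun p q (rotFun p q w) = -w := by
  obtain ⟨D, hD⟩ : ∃ D, D = dt p q := ⟨_, rfl⟩
  simp only [rotFun, ← hD]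
  rw [← hD] at h
  unfold dt at *
  ext
  · simp only [Prod.fst_neg]
    field_simp
    rw [hD]
    ring
  · simp only [Prod.snd_neg]
    field_simp
    rw [hD]
    ring

theorem rotFun_neg {F : Type*} [Field F] (p q w : F × F) :
    rotFun p q (-w) = - rotFun p q w := by
  ext <;> simp only [rotFun, dt, Prod.fst_neg, Prod.snd_neg] <;> ring

theorem rotFun_left {F : Type*} [Field F] (p q : F × F) (h : dt p q ≠ 0) :
    rotFun p q p = q := by
  have : dt p p = 0 := by unfold dt; ring
  ext <;> simp [rotFun, this, h]

/-- The symmetry as a permutation. -/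
def rotEquiv {F : Type*} [Field F] (p q : F × F) (h : dt p q ≠ 0) : Equiv.Perm (F × F) where
  toFun := rotFun p q
  invFun w := - rotFun p q w
  left_inv w := by
    change -rotFun p q (rotFun p q w) = w
    rw [rotFun_sq p q w h, neg_neg]
  right_inv w := by
    change rotFun p q (-rotFun p q w) = w
    rw [rotFun_neg, rotFun_sq p q w h, neg_neg]

theorem exists_lam {F : Type*} [Field F] (hN : 0 < N) (v : ℤ → F × F) (c : ℤ)
    (hv : ∀ x, c ≤ x → x < c + N → dt (v x) (v (x + 1)) = 1) (hX : dt (v c) (v (c + N)) ≠ 0) :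
    ∃ lam : Cl N → F, (∀ a b c d,
      lam (cl N a c) * lam (cl N b d) =
      lam (cl N a b) * lam (cl N c d) + lam (cl N b c) * lam (cl N d (a + 2 * N))) ∧
      (∀ a, lam (cl N a (a + 1)) = 1) ∧
      ∀ x y, c ≤ x → x ≤ c + N → c ≤ y → y ≤ c + N → lam (cl N x y) = dt (v x) (v y) := by
  obtain ⟨R, hR⟩ : ∃ R, R = rotEquiv (v c) (v (c + N)) hX := ⟨_, rfl⟩
  have hRf : ∀ w, R w = rotFun (v c) (v (c + N)) w := fun w => by rw [hR]; rfl
  obtain ⟨V, hV⟩ : ∃ V : ℤ → F × F, V = fun x => (R ^ ((x - c) / N)) (v (c + (x - c) % N)) := ⟨_, rfl⟩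
  have hV1 : ∀ x, V (x + N) = R (V x) := by
    intro x
    have h1 : (x + N - c) / N = 1 + (x - c) / N := by
      rw [show x + N - c = x - c + 1 * N by ring, Int.add_mul_ediv_right _ _ hN.ne']; ring
    have h2 : (x + N - c) % N = (x - c) % N := by
      rw [show x + N - c = x - c + N by ring, Int.add_emod_right]
    simp only [hV, h1, h2, _root_.zpow_one_add, Equiv.Perm.mul_apply]
  have hV0 : ∀ x, c ≤ x → x < c + N → V x = v x := by
    intro x h1 h2
    have h3 : (x - c) / N = 0 := Int.ediv_eq_zero_of_lt (by omega) (by omega)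
    have h4 : (x - c) % N = x - c := Int.emod_eq_of_lt (by omega) (by omega)
    simp [hV, h3, h4]
  have hVc : V (c + N) = v (c + N) := by
    rw [hV1, hV0 c le_rfl (by omega), hRf, rotFun_left _ _ hX]
  have hVv : ∀ x, c ≤ x → x ≤ c + N → V x = v x := by
    intro x h1 h2
    rcases h2.lt_or_eq with h | h
    · exact hV0 x h1 h
    · rw [h, hVc]
  have hD1 : ∀ x y, dt (V (x + N)) (V (y + N)) = dt (V x) (V y) := by
    intro x y
    rw [hV1, hV1, hRf, hRf, rotFun_dt _ _ _ _ hX]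
  have hDm : ∀ (m x y : ℤ), dt (V (x + m * N)) (V (y + m * N)) = dt (V x) (V y) := by
    intro m
    induction m using Int.induction_on with
    | zero => simp
    | succ i ih =>
      intro x y
      rw [← ih x y, ← hD1 (x + (i : ℤ) * N)]
      congr 2 <;> ring
    | pred i ih =>
      intro x y
      rw [← ih x y, ← hD1 (x + (-(i : ℤ) - 1) * N)]
      congr 2 <;> ring
  have hV2 : ∀ x, V (x + 2 * N) = - V x := by
    intro x
    rw [show x + 2 * N = x + N + N by ring, hV1, hV1, hRf, hRf, rotFun_sq _ _ _ hX]
  have hrot : ∀ x y, dt (V y) (V (x + 2 * N)) = dt (V x) (V y) := by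
    intro x y
    rw [hV2]; simp only [dt, Prod.fst_neg, Prod.snd_neg]; ring
  obtain ⟨lam, hlam⟩ : ∃ lam : Cl N → F, ∀ a b, lam (cl N a b) = dt (V a) (V b) := by
    refine ⟨Quotient.lift (fun x => dt (V x.1) (V x.2)) ?_, fun a b => rfl⟩
    rintro ⟨a, b⟩ ⟨a', b'⟩ ⟨m, ⟨h1, h2⟩ | ⟨h1, h2⟩⟩
    · simp only at h1 h2
      simp only [h1, h2, hDm]
    · simp only at h1 h2
      simp only [h1, h2]
      rw [hrot, hDm]
  refine ⟨lam, ?_, ?_, ?_⟩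
  · intro a b c d
    simp only [hlam, hrot]
    unfold dt; ring
  · have key : ∀ x, dt (V x) (V (x + 1)) = 1 := by
      intro x
      have h1 := hDm ((x - c) / N) (c + (x - c) % N) (c + (x - c) % N + 1)
      have h2 := Int.emod_nonneg (x - c) hN.ne'
      have h3 := Int.emod_lt_of_pos (x - c) hN
      have h4 : c + (x - c) % N + (x - c) / N * N = x := by
        have := Int.emod_add_mul_ediv (x - c) N
        linarith
      have h5 : c + (x - c) % N + 1 + (x - c) / N * N = x + 1 := by linarith
      rw [h4, h5] at h1
      rw [h1, hVv _ (by omega) (by omega), hVv _ (by omega) (by omega)]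
      exact hv _ (by omega) (by omega)
    intro a
    rw [hlam, key]
  · intro x y h1 h2 h3 h4
    rw [hlam, hVv x h1 h2, hVv y h3 h4]

/-- Vectors along a chain of nested chords. -/
theorem chain_vec {F : Type*} [Field F] (a : ℕ → ℤ)
    (ha : ∀ m, a (m + 1) = a m ∨ a (m + 1) = a m - 1) (X : ℕ → F) (m : ℕ)
    (hX : ∀ k ≤ m, X k ≠ 0) :
    ∃ v : ℤ → F × F, (∀ x, a m ≤ x → x < a m + m + 2 → dt (v x) (v (x + 1)) = 1) ∧
      ∀ k ≤ m, dt (v (a k)) (v (a k + k + 2)) = X k := by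
  induction m with
  | zero =>
    refine ⟨fun x => if x = a 0 then (1, 0) else if x = a 0 + 1 then (0, 1) else (-1, X 0), ?_, ?_⟩
    · intro x h1 h2
      have : x = a 0 ∨ x = a 0 + 1 := by push_cast at h2; omega
      rcases this with rfl | rfl
      · simp [dt]
      · simp [dt, show a 0 + 1 + 1 ≠ a 0 by omega]
    · intro k hk
      obtain rfl : k = 0 := by omega
      simp [dt]
  | succ m ih =>
    obtain ⟨v, h1, h2⟩ := ih (fun k hk => hX k (by omega))
    have hm := h2 m le_rfl
    have hXm := hX m (by omega)
    have anti : ∀ k j, k ≤ j → a j ≤ a k ∧ a k + k ≤ a j + j := by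
      intro k j hkj
      induction j, hkj using Nat.le_induction with
      | base => exact ⟨le_rfl, le_rfl⟩
      | succ j _ ih => have := ha j; push_cast; omega
    obtain ⟨p, hp⟩ : ∃ p, p = v (a m) := ⟨_, rfl⟩
    obtain ⟨q, hq⟩ : ∃ q, q = v (a m + m + 2) := ⟨_, rfl⟩
    rw [← hp, ← hq] at hm
    rcases ha m with h | h
    · -- new vertex on the right
      obtain ⟨z, hz1, hz2⟩ : ∃ z : F × F, dt q z = 1 ∧ dt p z = X (m + 1) := by
        refine ⟨(-(1 / X m) * p.1 + X (m + 1) / X m * q.1,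
          -(1 / X m) * p.2 + X (m + 1) / X m * q.2), ?_, ?_⟩
        · have e : dt q (-(1 / X m) * p.1 + X (m + 1) / X m * q.1,
              -(1 / X m) * p.2 + X (m + 1) / X m * q.2) = 1 / X m * dt p q := by
            unfold dt; ring
          rw [e, hm]
          field_simp
        · generalize X (m + 1) = W
          rw [← hm] at hXm ⊢
          unfold dt at hXm ⊢
          field_simp
          ring
      refine ⟨Function.update v (a m + m + 3) z, ?_, ?_⟩
      · intro x hx1 hx2
        push_cast at hx2
        rw [Function.update_of_ne (by omega)]
        by_cases hx : x = a m + m + 2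
        · rw [hx, show a m + m + 2 + 1 = a m + m + 3 by ring, Function.update_self, ← hq, hz1]
        · rw [Function.update_of_ne (by omega)]
          exact h1 x (by omega) (by omega)
      · intro k hk
        by_cases hk' : k = m + 1
        · subst hk'
          push_cast
          rw [h, Function.update_of_ne (by omega), show a m + ((m : ℤ) + 1) + 2 = a m + m + 3 by ring,
            Function.update_self, ← hp, hz2]
        · have := anti k m (by omega)
          rw [Function.update_of_ne (by omega), Function.update_of_ne (by omega)]
          exact h2 k (by omega)
    · obtain ⟨z, hz1, hz2⟩ : ∃ z : F × F, dt z p = 1 ∧ dt z q = X (m + 1) := by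
        refine ⟨(-(1 / X m) * q.1 + X (m + 1) / X m * p.1,
          -(1 / X m) * q.2 + X (m + 1) / X m * p.2), ?_, ?_⟩
        · rw [← hm] at hXm ⊢
          unfold dt at hXm ⊢
          field_simp
          ring
        · generalize X (m + 1) = W
          rw [← hm] at hXm ⊢
          unfold dt at hXm ⊢
          field_simp
          ring
      refine ⟨Function.update v (a m - 1) z, ?_, ?_⟩
      · intro x hx1 hx2
        push_cast at hx2
        rw [Function.update_of_ne (a := x + 1) (by omega)]
        by_cases hx : x = a m - 1
        · rw [hx, show a m - 1 + 1 = a m by ring, Function.update_self, ← hp, hz1]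
        · rw [Function.update_of_ne (by omega)]
          exact h1 x (by omega) (by omega)
      · intro k hk
        by_cases hk' : k = m + 1
        · subst hk'
          push_cast
          rw [h, Function.update_self, Function.update_of_ne (by omega),
            show a m - 1 + ((m : ℤ) + 1) + 2 = a m + m + 2 by ring, ← hq, hz2]
        · have := anti k m (by omega)
          rw [Function.update_of_ne (by omega), Function.update_of_ne (by omega)]
          exact h2 k (by omega)

/-! ### Part 6: the base triangulation of a type `C_n` seed -/

theorem SkewSymmetrizable.entry {B : Matrix (Fin n) (Fin n) ℤ} {d : Fin n → ℤ}
    (h : (Matrix.diagonal d * B)ᵀ = -(Matrix.diagonal d * B)) (i j : Fin n) :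
    d j * B j i = - (d i * B i j) := by
  have := congrFun (congrFun h i) j
  simpa [Matrix.transpose_apply, Matrix.diagonal_mul] using this

theorem skew_mut {B : Matrix (Fin n) (Fin n) ℤ} {d : Fin n → ℤ} (hd : ∀ i, 0 < d i)
    (h : ∀ i j, d j * B j i = - (d i * B i j)) (k : Fin n) :
    ∀ i j, d j * mutMat k B j i = - (d i * mutMat k B i j) := by
  intro i j
  unfold mutMat
  by_cases h1 : i = k
  · simp only [h1, or_true, if_true, true_or]
    have := h k j
    linarith
  by_cases h2 : j = k
  · simp only [h2, or_true, if_true, true_or]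
    have := h i k
    linarith
  · simp only [h1, h2, or_self, if_false]
    have e1 := h i j
    have e2 := h i k
    have e3 := h k j
    have hs : ∀ p q : Fin n, (B p q).sign = - (B q p).sign := by
      intro p q
      have e := h q p
      have hp := hd p; have hq := hd q
      rcases lt_trichotomy (B q p) 0 with h' | h' | h'
      · have : 0 < B p q := by nlinarith
        rw [Int.sign_eq_one_of_pos this, Int.sign_eq_neg_one_of_neg h']; rfl
      · have : B p q = 0 := by
          rw [h'] at e
          rcases mul_eq_zero.1 (show d p * B p q = 0 by linarith) with h'' | h''
          · omega
          · exact h''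
        rw [this, h']; rfl
      · have : B p q < 0 := by nlinarith
        rw [Int.sign_eq_one_of_pos h', Int.sign_eq_neg_one_of_neg this]
    have hi := hd i; have hj := hd j; have hk := hd k
    -- `d_j B_jk B_ki = d_i B_ik B_kj` up to sign
    have e4 : d j * (B j k * B k i) = d i * (B i k * B k j) := by
      have : d j * B j k = - (d k * B k j) := by linarith
      calc d j * (B j k * B k i) = (d j * B j k) * B k i := by ring
        _ = - ((d k * B k i) * B k j) := by rw [this]; ring
        _ = d i * (B i k * B k j) := by rw [e2]; ring
    have e5 : d j * max (B j k * B k i) 0 = d i * max (B i k * B k j) 0 := by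
      rw [mul_max_of_nonneg _ _ hj.le, mul_max_of_nonneg _ _ hi.le, e4]; simp
    by_cases hz : 0 < B i k * B k j
    · have e6 : (B j k).sign = - (B i k).sign := by
        rw [hs j k]
        rcases pos_and_pos_or_neg_and_neg_of_mul_pos hz with ⟨p, q⟩ | ⟨p, q⟩
        · rw [Int.sign_eq_one_of_pos p, Int.sign_eq_one_of_pos q]
        · rw [Int.sign_eq_neg_one_of_neg p, Int.sign_eq_neg_one_of_neg q]
      rw [e6]
      linear_combination e1 - (B i k).sign * e5
    · have e7 : max (B i k * B k j) 0 = 0 := max_eq_right (by omega)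
      rw [e7] at e5 ⊢
      have e8 : max (B j k * B k i) 0 = 0 := by
        rcases mul_eq_zero.1 (show d j * max (B j k * B k i) 0 = 0 by linarith) with h'' | h''
        · omega
        · exact h''
      rw [e8]
      simpa using e1

theorem IsSeed.skew {B₀ : Matrix (Fin n) (Fin n) ℤ}
    {s : Matrix (Fin n) (Fin n) ℤ × (Fin n → CAField n)} (hs : IsSeed B₀ s) {d : Fin n → ℤ}
    (hd : ∀ i, 0 < d i) (h : ∀ i j, d j * B₀ j i = - (d i * B₀ i j)) :
    ∀ i j, d j * s.1 j i = - (d i * s.1 i j) := by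
  induction hs with
  | refl => exact h
  | tail _ h2 ih =>
    obtain ⟨k, rfl⟩ := h2
    exact skew_mut hd ih k

/-- Left endpoints of the chain of chords. -/
def chA (ε : ℕ → Prop) [DecidablePred ε] : ℕ → ℤ
  | 0 => 0
  | m + 1 => if ε m then chA ε m else chA ε m - 1

theorem chA_nest (ε : ℕ → Prop) [DecidablePred ε] {i j : ℕ} (h : i ≤ j) :
    chA ε j ≤ chA ε i ∧ chA ε i + i ≤ chA ε j + j := by
  induction j, h using Nat.le_induction with
  | base => exact ⟨le_rfl, le_rfl⟩
  | succ j _ ih =>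
    have : chA ε (j + 1) = chA ε j ∨ chA ε (j + 1) = chA ε j - 1 := by
      rw [chA]; split_ifs <;> simp
    push_cast
    omega

/-- The labelling by the chain of chords. -/
def chX (n : ℕ) (ε : ℕ → Prop) [DecidablePred ε] (j : Fin n) : Cl ((n : ℤ) + 1) :=
  cl _ (chA ε j) (chA ε j + j + 2)

theorem chX_inj (ε : ℕ → Prop) [DecidablePred ε] : Function.Injective (chX n ε) := by
  intro i j h
  obtain ⟨t, ht, h⟩ := cl_cases (by omega) h
  have hi := i.2; have hj := j.2
  apply Fin.ext
  omega

theorem chX_nc (ε : ℕ → Prop) [DecidablePred ε] (a b c d : ℤ) (h1 : a < c) (h2 : c < b) (h3 : b < d)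
    (h4 : d < a + 2 * ((n : ℤ) + 1)) (e : Ed ((n : ℤ) + 1) (chX n ε) a b)
    (e' : Ed ((n : ℤ) + 1) (chX n ε) c d) : False := by
  obtain ⟨i, hi⟩ := e.label (by omega) (by omega)
  obtain ⟨j, hj⟩ := e'.label (by omega) (by omega)
  obtain ⟨m, hm⟩ := cl_exact hi
  obtain ⟨m', hm'⟩ := cl_exact hj
  have hk := mult_cases (N := (n : ℤ) + 1) (by omega) (m' - m)
  rw [sub_mul] at hk
  have hi' := i.2; have hj' := j.2
  generalize m * ((n : ℤ) + 1) = T at *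
  generalize m' * ((n : ℤ) + 1) = T' at *
  have hl : (i.val ≤ j.val ∧ chA ε j ≤ chA ε i ∧ chA ε i + i ≤ chA ε j + j) ∨
     (j.val ≤ i.val ∧ chA ε i ≤ chA ε j ∧ chA ε j + j ≤ chA ε i + i) := by
    rcases le_total i.val j.val with h | h
    · exact Or.inl ⟨h, chA_nest ε h⟩
    · exact Or.inr ⟨h, chA_nest ε h⟩
  generalize chA ε i = A at *
  generalize chA ε j = A' at *
  clear hi hj e e'
  rcases hm with hm | hm <;> rcases hm' with hm' | hm' <;> rcases hl with hl | hl <;>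
    rcases hk with hk | hk | hk | hk | hk | hk | hk <;> omega

theorem ind_of_label {i j : Fin n} (hχ : Function.Injective χ) {x y : ℤ} (h : χ j = cl N x y) :
    ind χ i x y = if i = j then 1 else 0 := by
  split_ifs with h'
  · rw [h', ind_pos h]
  · exact ind_neg (fun h'' => h' (hχ (h''.trans h.symm)))

theorem chX_bd (ε : ℕ → Prop) [DecidablePred ε] (i : Fin n) (x : ℤ) :
    ind (chX n ε) i x (x + 1) = 0 := by
  apply ind_neg
  intro h
  obtain ⟨t, ht, h⟩ := cl_cases (by omega) h
  have hi := i.2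
  omega

/-- Inner triangle of a chord of the chain. -/
theorem chX_inner (ε : ℕ → Prop) [DecidablePred ε] (m : Fin n) :
    ∃ e, chA ε m < e ∧ e < chA ε m + m + 2 ∧ Ed ((n : ℤ) + 1) (chX n ε) (chA ε m) e ∧
      Ed ((n : ℤ) + 1) (chX n ε) e (chA ε m + m + 2) ∧
      ∀ i : Fin n, ind (chX n ε) i (chA ε m) e - ind (chX n ε) i e (chA ε m + m + 2) =
        if i.val + 1 = m.val then (if ε i then 1 else -1) else 0 := by
  obtain ⟨m, hm⟩ := m
  cases m with
  | zero =>
    refine ⟨chA ε 0 + 1, by simp, by simp, Or.inl rfl, Or.inl (by simp; ring), ?_⟩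
    intro i
    simp only [Nat.cast_zero, add_zero]
    rw [show chA ε 0 + 2 = chA ε 0 + 1 + 1 by ring, chX_bd, chX_bd]
    simp
  | succ m =>
    have hlab : chX n ε ⟨m, by omega⟩ = cl _ (chA ε m) (chA ε m + m + 2) := rfl
    by_cases hε : ε m
    · have hA : chA ε (m + 1) = chA ε m := by rw [chA, if_pos hε]
      simp only [hA]
      push_cast
      refine ⟨chA ε m + m + 2, by omega, by omega, Or.inr (Or.inr ⟨_, hlab⟩), Or.inl (by ring), ?_⟩
      intro i
      rw [show chA ε m + ((m : ℤ) + 1) + 2 = chA ε m + m + 2 + 1 by ring, chX_bd,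
        ind_of_label (chX_inj ε) hlab]
      by_cases hi : i = ⟨m, by omega⟩
      · rw [if_pos hi, hi]; simp [hε]
      · rw [if_neg hi, if_neg]
        · simp
        · intro h; exact hi (Fin.ext (by simpa using h))
    · have hA : chA ε (m + 1) = chA ε m - 1 := by rw [chA, if_neg hε]
      simp only [hA]
      push_cast
      have e : chA ε m - 1 + ((m : ℤ) + 1) + 2 = chA ε m + m + 2 := by ring
      rw [e]
      refine ⟨chA ε m, by omega, by omega, Or.inl (by ring), Or.inr (Or.inr ⟨_, hlab⟩), ?_⟩
      intro i
      have e2 : ind (chX n ε) i (chA ε m - 1) (chA ε m) = 0 := by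
        have := chX_bd ε i (chA ε m - 1)
        rwa [sub_add_cancel] at this
      rw [e2, ind_of_label (chX_inj ε) hlab]
      by_cases hi : i = ⟨m, by omega⟩
      · rw [if_pos hi, hi]; simp [hε]
      · rw [if_neg hi, if_neg]
        · simp
        · intro h; exact hi (Fin.ext (by simpa using h))

/-- Outer triangle of a chord of the chain. -/
theorem chX_outer (ε : ℕ → Prop) [DecidablePred ε] (m : ℕ) (hm : m + 1 < n) :
    ∃ d, chA ε m + m + 2 < d ∧ d < chA ε m + 2 * ((n : ℤ) + 1) ∧
      Ed ((n : ℤ) + 1) (chX n ε) (chA ε m + m + 2) d ∧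
      Ed ((n : ℤ) + 1) (chX n ε) d (chA ε m + 2 * ((n : ℤ) + 1)) ∧
      ∀ i : Fin n, ind (chX n ε) i (chA ε m + m + 2) d -
        ind (chX n ε) i d (chA ε m + 2 * ((n : ℤ) + 1)) =
        if i.val = m + 1 then (if ε m then -1 else 1) else 0 := by
  have hlab : chX n ε ⟨m + 1, by omega⟩ =
    cl _ (chA ε (m + 1)) (chA ε (m + 1) + ((m + 1 : ℕ) : ℤ) + 2) := rfl
  push_cast at hlab
  by_cases hε : ε m
  · have hA : chA ε (m + 1) = chA ε m := by rw [chA, if_pos hε]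
    rw [hA, ← cl_rot, show chA ε m + ((m : ℤ) + 1) + 2 = chA ε m + m + 2 + 1 by ring] at hlab
    refine ⟨chA ε m + m + 2 + 1, by omega, by omega, Or.inl rfl, Or.inr (Or.inr ⟨_, hlab⟩), ?_⟩
    intro i
    rw [chX_bd, ind_of_label (chX_inj ε) hlab]
    by_cases hi : i = ⟨m + 1, by omega⟩
    · rw [if_pos hi, hi]; simp [hε]
    · rw [if_neg hi, if_neg]
      · simp
      · intro h; exact hi (Fin.ext (by simpa using h))
  · have hA : chA ε (m + 1) = chA ε m - 1 := by rw [chA, if_neg hε]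
    rw [hA, ← cl_rot, show chA ε m - 1 + ((m : ℤ) + 1) + 2 = chA ε m + m + 2 by ring] at hlab
    refine ⟨_, ?_, ?_, Or.inr (Or.inr ⟨_, hlab⟩), Or.inl (by ring), ?_⟩
    · omega
    · omega
    intro i
    have e2 : ind (chX n ε) i (chA ε m - 1 + 2 * ((n : ℤ) + 1)) (chA ε m + 2 * ((n : ℤ) + 1)) = 0 := by
      have := chX_bd ε i (chA ε m - 1 + 2 * ((n : ℤ) + 1))
      rwa [show chA ε m - 1 + 2 * ((n : ℤ) + 1) + 1 = chA ε m + 2 * ((n : ℤ) + 1) by ring] at this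
    rw [e2, ind_of_label (chX_inj ε) hlab]
    by_cases hi : i = ⟨m + 1, by omega⟩
    · rw [if_pos hi, hi]; simp [hε]
    · rw [if_neg hi, if_neg]
      · simp
      · intro h; exact hi (Fin.ext (by simpa using h))

theorem chX_model (hn : 2 ≤ n) (ε : ℕ → Prop) [DecidablePred ε] (B : Matrix (Fin n) (Fin n) ℤ)
    (hB : ∀ i j : Fin n, B i j =
      (if i.val + 1 = j.val then (if ε i then 1 else -1) * (if j.val + 1 = n then 2 else 1) else 0) +
      (if i.val = j.val + 1 then (if ε j then -1 else 1) else 0)) :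
    Model ((n : ℤ) + 1) B (chX n ε) where
  inj := chX_inj ε
  nc := chX_nc ε
  diam := ⟨chA ε (n - 1), ⟨n - 1, by omega⟩, by
    simp only [chX]; congr 1; have : ((n - 1 : ℕ) : ℤ) = n - 1 := by omega
    rw [this]; ring⟩
  quad := by
    intro j
    have hj := j.2
    obtain ⟨e, h1, h2, e1, e2, hc⟩ := chX_inner ε j
    by_cases hl : j.val + 1 < n
    · obtain ⟨d, h3, h4, e3, e4, hc'⟩ := chX_outer ε j.val hl
      refine ⟨_, e, _, d, h1, h2, h3, h4, rfl, e1, e2, e3, e4, ?_⟩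
      intro i
      rw [hB, if_neg (show ¬ (j.val + 1 = n) by omega), mul_one]
      linarith [hc i, hc' i]
    · have hjn : (j.val : ℤ) + 1 = n := by omega
      have hb : chA ε j + j + 2 = chA ε j + ((n : ℤ) + 1) := by omega
      rw [hb] at hc h2 e2
      have s1 : ∀ i, ind (chX n ε) i (chA ε j + ((n : ℤ) + 1)) (e + ((n : ℤ) + 1)) =
        ind (chX n ε) i (chA ε j) e := fun i => ind_congr _ _ (cl_shift1 _ _ _)
      have s2 : ∀ i, ind (chX n ε) i (e + ((n : ℤ) + 1)) (chA ε j + 2 * ((n : ℤ) + 1)) =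
        ind (chX n ε) i e (chA ε j + ((n : ℤ) + 1)) := by
        intro i
        rw [show chA ε j + 2 * ((n : ℤ) + 1) = chA ε j + ((n : ℤ) + 1) + ((n : ℤ) + 1) by ring]
        exact ind_congr _ _ (cl_shift1 _ _ _)
      refine ⟨_, e, _, e + ((n : ℤ) + 1), h1, h2, by omega, by omega, ?_, e1, e2, e1.shift1, ?_, ?_⟩
      · rw [← hb]; rfl
      · have := e2.shift1
        rwa [show chA ε j + ((n : ℤ) + 1) + ((n : ℤ) + 1) = chA ε j + 2 * ((n : ℤ) + 1) by ring] at this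
      · intro i
        have hi := i.2
        rw [hB, if_pos (show (j.val + 1 = n) by omega), if_neg (show ¬ i.val = j.val + 1 by omega),
          s1, s2]
        have := hc i
        split_ifs at this ⊢ <;> linarith

theorem Model.relabel {B : Matrix (Fin n) (Fin n) ℤ} {χ : Fin n → Cl N} (σ : Equiv.Perm (Fin n))
    (M : Model N (fun i j => B (σ i) (σ j)) χ) : Model N B (fun i => χ (σ.symm i)) := by
  have hEd : ∀ a b, Ed N (fun i => χ (σ.symm i)) a b ↔ Ed N χ a b := by
    intro a b
    unfold Ed
    refine or_congr Iff.rfl (or_congr Iff.rfl ?_)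
    constructor
    · rintro ⟨j, h⟩; exact ⟨_, h⟩
    · rintro ⟨j, h⟩; exact ⟨σ j, by simpa using h⟩
  refine ⟨M.inj.comp σ.symm.injective, ?_, ?_, ?_⟩
  · intro a b c d h1 h2 h3 h4 e1 e2
    exact M.nc a b c d h1 h2 h3 h4 ((hEd _ _).1 e1) ((hEd _ _).1 e2)
  · obtain ⟨c, j, h⟩ := M.diam
    exact ⟨c, σ j, by simpa using h⟩
  · intro j
    obtain ⟨a, b, c, d, q⟩ := M.quad (σ.symm j)
    refine ⟨a, b, c, d, q.h1, q.h2, q.h3, q.h4, q.hj, (hEd _ _).2 q.e1, (hEd _ _).2 q.e2,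
      (hEd _ _).2 q.e3, (hEd _ _).2 q.e4, ?_⟩
    intro i
    have := q.col (σ.symm i)
    simp only [Equiv.apply_symm_apply] at this
    rw [this]
    rfl

open scoped Classical in
theorem base_good (hn : 2 ≤ n) {B₀ : Matrix (Fin n) (Fin n) ℤ} (hB : SkewSymmetrizable B₀)
    (htype : PatternOfType (cartanC n) B₀) :
    ∃ (lam : Cl ((n : ℤ) + 1) → CAField n) (χ : Fin n → Cl ((n : ℤ) + 1)),
      IsLam ((n : ℤ) + 1) lam ∧ Good ((n : ℤ) + 1) lam (B₀, uVar n) χ := by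
  obtain ⟨s, hs, σ, hσ⟩ := htype
  obtain ⟨δ, hδ, hsk⟩ := hB
  have hsk' := hs.skew hδ (fun i j => SkewSymmetrizable.entry hsk i j)
  have hnz : ∀ j, s.2 j ≠ 0 := fun j => ((hs.orded ⟨0, by omega⟩) j).choose_spec.ne_zero
  have hdiag : ∀ i, s.1 i i = 0 := by
    intro i
    have := hsk' i i
    have h := hδ i
    rcases mul_eq_zero.1 (show δ i * s.1 i i = 0 by linarith) with h'' | h''
    · omega
    · exact h''
  have hsgn : ∀ i j, 0 < s.1 i j → s.1 j i < 0 := by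
    intro i j h
    have := hsk' i j
    have h1 := hδ i; have h2 := hδ j
    nlinarith
  have hsgn' : ∀ i j, s.1 i j < 0 → 0 < s.1 j i := by
    intro i j h
    have := hsk' i j
    have h1 := hδ i; have h2 := hδ j
    nlinarith
  obtain ⟨ε, hε⟩ : ∃ ε : ℕ → Prop, ε = fun m => ∃ h : m + 1 < n, 0 < s.1 (σ ⟨m, by omega⟩) (σ ⟨m + 1, h⟩) :=
    ⟨_, rfl⟩
  have M0 : Model ((n : ℤ) + 1) (fun i j => s.1 (σ i) (σ j)) (chX n ε) := by
    apply chX_model hn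
    intro i j
    have hi := i.2; have hj := j.2
    by_cases hij : i = j
    · subst hij
      rw [hdiag]; simp
    have hc := hσ i j
    have hij' : i.val ≠ j.val := fun h => hij (Fin.ext h)
    unfold cartanCounterpart cartanC at hc
    rw [if_neg hij, if_neg (fun h => hij (σ.injective h))] at hc
    by_cases h1 : i.val + 1 = j.val
    · have hεi : ε i.val ↔ 0 < s.1 (σ i) (σ j) := by
        have e : (⟨i.val + 1, by omega⟩ : Fin n) = j := Fin.ext h1
        simp only [hε]
        constructor
        · rintro ⟨h, h'⟩; rw [← e]; exact h'
        · intro h; exact ⟨by omega, by rw [e]; exact h⟩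
      simp only [hεi]
      rw [if_pos h1, if_neg (show ¬ i.val = j.val + 1 by omega)]
      rcases abs_cases (s.1 (σ i) (σ j)) with ⟨ha, hb⟩ | ⟨ha, hb⟩
      · split_ifs at hc ⊢ <;> omega
      · split_ifs at hc ⊢ <;> omega
    · by_cases h2 : i.val = j.val + 1
      · have hεj : ε j.val ↔ 0 < s.1 (σ j) (σ i) := by
          have e : (⟨j.val + 1, by omega⟩ : Fin n) = i := Fin.ext h2.symm
          simp only [hε]
          constructor
          · rintro ⟨h, h'⟩; rw [← e]; exact h'
          · intro h; exact ⟨by omega, by rw [e]; exact h⟩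
        simp only [hεj]
        rw [if_neg h1, if_pos h2]
        have k1 := hsgn (σ i) (σ j)
        have k2 := hsgn' (σ i) (σ j)
        rcases abs_cases (s.1 (σ i) (σ j)) with ⟨ha, hb⟩ | ⟨ha, hb⟩
        · split_ifs at hc ⊢ <;> omega
        · split_ifs at hc ⊢ <;> omega
      · rw [if_neg h1, if_neg h2]
        have : s.1 (σ i) (σ j) = 0 := by
          rw [if_neg (by omega), if_neg (by omega)] at hc
          simpa using hc
        rw [this]; rfl
  have M1 := M0.relabel σ
  obtain ⟨X, hX⟩ : ∃ X : ℕ → CAField n, X = fun m => if h : m < n then s.2 (σ ⟨m, h⟩) else 1 := ⟨_, rfl⟩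
  have hX0 : ∀ m, X m ≠ 0 := by
    intro m
    simp only [hX]
    split_ifs
    · exact hnz _
    · exact one_ne_zero
  have hchA : ∀ m, chA ε (m + 1) = chA ε m ∨ chA ε (m + 1) = chA ε m - 1 := by
    intro m; rw [chA]; split_ifs <;> simp
  obtain ⟨v, hv1, hv2⟩ := chain_vec (chA ε) hchA X (n - 1) (fun k _ => hX0 k)
  have hcast : ((n - 1 : ℕ) : ℤ) = n - 1 := by omega
  have hlast : chA ε (n - 1) + ((n - 1 : ℕ) : ℤ) + 2 = chA ε (n - 1) + ((n : ℤ) + 1) := by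
    rw [hcast]; ring
  obtain ⟨lam, L1, L2, L3⟩ := exists_lam (N := (n : ℤ) + 1) (by omega) v (chA ε (n - 1))
    (fun x h1 h2 => hv1 x h1 (by omega)) (by rw [← hlast, hv2 (n - 1) le_rfl]; exact hX0 _)
  have L : IsLam ((n : ℤ) + 1) lam := ⟨fun a b c d _ _ _ _ => L1 a b c d, L2⟩
  refine ⟨lam, ?_⟩
  have G : Good ((n : ℤ) + 1) lam s (fun i => chX n ε (σ.symm i)) := by
    refine ⟨M1, fun j => ?_⟩
    obtain ⟨m, rfl⟩ := σ.surjective j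
    have hm := m.2
    have hnest := chA_nest ε (show m.val ≤ n - 1 by omega)
    simp only [Equiv.symm_apply_apply, chX]
    rw [L3 _ _ (by omega) (by omega) (by omega) (by omega), hv2 m.val (by omega)]
    simp [hX]
  obtain ⟨χ', G'⟩ := Good.initial L ⟨0, by omega⟩ hs G
  exact ⟨χ', L, G'⟩

/-! ### Part 7: reaching compatible chords and orders along `u_i` -/

/-- Seeds reached from the initial one without mutating at `i`. -/
structure SeedInv (N : ℤ) (lam : Cl N → CAField n) (B₀ : Matrix (Fin n) (Fin n) ℤ) (i : Fin n)
    (β : Cl N) (s : Matrix (Fin n) (Fin n) ℤ × (Fin n → CAField n)) (χ : Fin n → Cl N) : Prop where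
  seed : IsSeed B₀ s
  G : Good N lam s χ
  hi : χ i = β
  ui : s.2 i = uVar n i
  ord : ∀ j, j ≠ i → HasOrd i (s.2 j) 0

section reach

variable {lam : Cl N → CAField n} {B₀ : Matrix (Fin n) (Fin n) ℤ} {i : Fin n} {β : Cl N}
  {s : Matrix (Fin n) (Fin n) ℤ × (Fin n → CAField n)}

theorem SeedInv.edge (L : IsLam N lam) (I : SeedInv N lam B₀ i β s χ) {x y : ℤ} (h : Ed N χ x y) :
    HasOrd i (lam (cl N x y)) (ind χ i x y) := by
  have hb : (lam (cl N x y) = 1 ∧ (y = x + 1 ∨ y = x + 2 * N - 1)) →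
      HasOrd i (lam (cl N x y)) (ind χ i x y) := by
    rintro ⟨h1, h2⟩
    rw [h1, ind_neg]
    · exact HasOrd.one
    · intro h'
      have := I.G.M.labelLen h'
      omega
  rcases h with h | h | ⟨j, h⟩
  · exact hb ⟨by rw [h, L.bdry], Or.inl h⟩
  · exact hb ⟨by rw [h, L.bdry'], Or.inr h⟩
  · rw [ind_of_label I.G.M.inj h, ← h, ← I.G.val j]
    split_ifs with hij
    · rw [← hij, I.ui]; exact HasOrd.uVar_self
    · exact I.ord j (Ne.symm hij)

theorem SeedInv.step (L : IsLam N lam) (I : SeedInv N lam B₀ i β s χ) {k : Fin n} {a b c d : ℤ}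
    (q : Quad N s.1 χ k a b c d) (hk : k ≠ i) :
    SeedInv N lam B₀ i β (mutSeed k s) (Function.update χ k (cl N b d)) := by
  have hk0 : s.2 k ≠ 0 := (I.ord k hk).ne_zero
  have G' := I.G.mut L q hk0
  refine ⟨I.seed.tail ⟨k, rfl⟩, G', ?_, ?_, ?_⟩
  · rw [Function.update_of_ne hk.symm, I.hi]
  · simp only [mutSeed, Function.update_of_ne hk.symm, I.ui]
  · intro j hj
    by_cases hjk : j = k
    · subst hjk
      rw [G'.val j, Function.update_self]
      have e : lam (cl N b d) = (lam (cl N a b) * lam (cl N c d) +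
          lam (cl N b c) * lam (cl N d (a + 2 * N))) / s.2 j := by
        rw [eq_div_iff hk0, ← L.ptol a b c d q.h1 q.h2 q.h3 q.h4, I.G.val j, q.hj, mul_comm]
      rw [e]
      have h := ((((I.edge L q.e1).mul (I.edge L q.e3)).add
        ((I.edge L q.e2).mul (I.edge L q.e4))).div (I.ord j hj))
      convert h using 1
      have p1 := ind_nonneg χ i a b; have p2 := ind_nonneg χ i b c
      have p3 := ind_nonneg χ i c d; have p4 := ind_nonneg χ i d (a + 2 * N)
      rcases q.posneg i with h' | h' <;> omega
    · simp only [mutSeed, Function.update_of_ne hjk]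
      exact I.ord j hj

/-- `(a,b)` does not cross any chord of the class `β`. -/
def NC (N : ℤ) (β : Cl N) (a b : ℤ) : Prop :=
  ∀ p q, cl N p q = β → ¬ (a < p ∧ p < b ∧ b < q ∧ q < a + 2 * N)

theorem NC.left {a b p q : ℤ} (h : NC N β a b) (hpq : cl N p q = β) :
    ¬ (p < a ∧ a < q ∧ q < b ∧ b < p + 2 * N) := by
  rintro ⟨h1, h2, h3, h4⟩
  exact h q (p + 2 * N) (by rw [cl_rot, hpq]) ⟨h2, h3, h4, by omega⟩

theorem NC.rot {a b : ℤ} (h : NC N β a b) : NC N β b (a + 2 * N) := by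
  rintro p q hpq ⟨h1, h2, h3, h4⟩
  refine h (q - 2 * N) p ?_ ⟨by omega, by omega, by omega, by omega⟩
  rw [← hpq, ← cl_rot N (q - 2 * N) p, sub_add_cancel]

theorem Model.two_le (M : Model N B χ) : 2 ≤ N := by
  obtain ⟨c, j, h⟩ := M.diam
  have := M.labelLen h
  omega

theorem Model.descend (M : Model N B χ) {x : ℤ} (m : ℕ) : ∀ {p q : ℤ}, (q - p).toNat ≤ m →
    p < x → x < q → q - p ≤ N → Ed N χ p q →
    ∃ k p' q' d, p ≤ p' ∧ p' < x ∧ x < q' ∧ q' ≤ q ∧ Quad N B χ k p' x q' d := by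
  have h2 := M.two_le
  induction m with
  | zero => intro p q h h1 h2; omega
  | succ m ih =>
    intro p q hm h1 h2 h3 e
    obtain ⟨k, hk⟩ := e.label (by omega) (by omega)
    obtain ⟨v, d, Q⟩ := M.quadAt hk
    have q1 := Q.h1; have q2 := Q.h2
    rcases lt_trichotomy v x with h | h | h
    · obtain ⟨k, p', q', d, a1, a2, a3, a4, a5⟩ := ih (p := v) (q := q) (by omega) h h2 (by omega) Q.e2
      exact ⟨k, p', q', d, by omega, a2, a3, a4, a5⟩
    · subst h
      exact ⟨k, p, q, d, le_rfl, h1, h2, le_rfl, Q⟩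
    · obtain ⟨k, p', q', d, a1, a2, a3, a4, a5⟩ := ih (p := p) (q := v) (by omega) h1 h (by omega) Q.e1
      exact ⟨k, p', q', d, a1, a2, a3, by omega, a5⟩

/-- Crossing chords of `(a,b)` inside the half polygon starting at `c`. -/
def crossSet (N : ℤ) (χ : Fin n → Cl N) (c a b : ℤ) : Set (Fin n) :=
  {j | ∃ p q, c ≤ p ∧ p < q ∧ q ≤ c + N ∧ χ j = cl N p q ∧ ((p < a ∧ a < q ∧ q < b) ∨
    (a < p ∧ p < b ∧ b < q))}

theorem Model.maxEd (M : Model N B χ) {c a b : ℤ} (hab : a < b) (hc : crossSet N χ c a b = ∅)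
    (m : ℕ) : ∀ {p q : ℤ}, (q - p).toNat ≤ m → c ≤ p → p ≤ a → b ≤ q → q ≤ c + N → Ed N χ p q →
    Ed N χ a b := by
  have h2 := M.two_le
  induction m with
  | zero => intro p q h h1 h2; omega
  | succ m ih =>
    intro p q hm h1 h2 h3 h4 e
    by_cases hpq : p = a ∧ q = b
    · rw [← hpq.1, ← hpq.2]; exact e
    obtain ⟨k, hk⟩ := e.label (by omega) (by omega)
    obtain ⟨v, d, Q⟩ := M.quadAt hk
    have q1 := Q.h1; have q2 := Q.h2
    by_cases hv1 : v ≤ a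
    · exact ih (p := v) (q := q) (by omega) (by omega) hv1 h3 h4 Q.e2
    by_cases hv2 : b ≤ v
    · exact ih (p := p) (q := v) (by omega) (by omega) h2 hv2 (by omega) Q.e1
    exfalso
    by_cases hp : p < a
    · obtain ⟨j, hj⟩ := Q.e1.label (by omega) (by omega)
      have : j ∈ crossSet N χ c a b :=
        ⟨p, v, h1, q1, by omega, hj, Or.inl ⟨hp, by omega, by omega⟩⟩
      rw [hc] at this; exact this
    · obtain ⟨j, hj⟩ := Q.e2.label (by omega) (by omega)
      have : j ∈ crossSet N χ c a b :=
        ⟨v, q, by omega, q2, by omega, hj, Or.inr ⟨by omega, by omega, by omega⟩⟩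
      rw [hc] at this; exact this

theorem ncard_drop {S T : Set (Fin n)} {k : Fin n} (hk : k ∈ S) (h : ∀ j, j ∈ T → j ≠ k ∧ j ∈ S) :
    T.ncard < S.ncard := by
  apply Set.ncard_lt_ncard _ (Set.toFinite S)
  refine ⟨fun j hj => (h j hj).2, fun h' => (h k (h' hk)).1 rfl⟩

theorem SeedInv.stage2 (L : IsLam N lam) {c a b : ℤ} (h1 : c ≤ a) (h2 : a < b) (h3 : b ≤ c + N)
    (hnc : NC N β a b) (m : ℕ) : ∀ {s : Matrix (Fin n) (Fin n) ℤ × (Fin n → CAField n)}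
    {χ : Fin n → Cl N}, (crossSet N χ c a b).ncard ≤ m → SeedInv N lam B₀ i β s χ →
    Ed N χ c (c + N) → ∃ s' χ', SeedInv N lam B₀ i β s' χ' ∧ Ed N χ' a b := by
  have fin0 : ∀ {s : Matrix (Fin n) (Fin n) ℤ × (Fin n → CAField n)}
    {χ : Fin n → Cl N}, crossSet N χ c a b = ∅ → SeedInv N lam B₀ i β s χ →
    Ed N χ c (c + N) → ∃ s' χ', SeedInv N lam B₀ i β s' χ' ∧ Ed N χ' a b := by
    intro s χ h0 I e
    exact ⟨s, χ, I, I.G.M.maxEd h2 h0 _ le_rfl le_rfl h1 h3 le_rfl e⟩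
  induction m with
  | zero =>
    intro s χ hm I e
    exact fin0 ((Set.ncard_eq_zero (Set.toFinite _)).1 (by omega)) I e
  | succ m ih =>
    intro s χ hm I e
    rcases Set.eq_empty_or_nonempty (crossSet N χ c a b) with h0 | ⟨j, p, q, g1, g2, g3, g4, g5⟩
    · exact fin0 h0 I e
    have M := I.G.M
    have hN := M.two_le
    rcases g5 with ⟨g5, g6, g7⟩ | ⟨g5, g6, g7⟩
    · obtain ⟨k, p', q', d, a1, a2, a3, a4, Q⟩ := M.descend (x := a) _ le_rfl g5 g6 (by omega)
        (Or.inr (Or.inr ⟨j, g4⟩))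
      have q3 := Q.h3; have q4 := Q.h4
      have hki : k ≠ i := by
        rintro rfl
        exact hnc.left (Q.hj.symm.trans I.hi) ⟨by omega, by omega, by omega, by omega⟩
      have hd : d ≤ c + N ∨ c + 2 * N ≤ d := by
        by_contra hd
        exact M.nc c (c + N) q' d (by omega) (by omega) (by omega) (by omega) e Q.e3
      have hkS : k ∈ crossSet N χ c a b :=
        ⟨p', q', by omega, by omega, by omega, Q.hj, Or.inl ⟨by omega, by omega, by omega⟩⟩
      refine ih (s := mutSeed k s) (χ := Function.update χ k (cl N a d)) ?_ (I.step L Q hki) ?_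
      · have := ncard_drop (T := crossSet N (Function.update χ k (cl N a d)) c a b) hkS ?_
        · omega
        rintro l ⟨x, y, b1, b2, b3, b4, b5⟩
        have hl : l ≠ k := by
          rintro rfl
          rw [Function.update_self] at b4
          obtain ⟨t, ht, b4⟩ := cl_cases (by omega) b4
          omega
        rw [Function.update_of_ne hl] at b4
        exact ⟨hl, x, y, b1, b2, b3, b4, b5⟩
      · apply e.upd
        rw [Q.hj]
        intro h
        obtain ⟨t, ht, h⟩ := cl_cases (by omega) h
        omega
    · obtain ⟨k, p', q', d, a1, a2, a3, a4, Q⟩ := M.descend (x := b) _ le_rfl g6 g7 (by omega)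
        (Or.inr (Or.inr ⟨j, g4⟩))
      have q3 := Q.h3; have q4 := Q.h4
      have hki : k ≠ i := by
        rintro rfl
        exact hnc p' q' (Q.hj.symm.trans I.hi) ⟨by omega, by omega, by omega, by omega⟩
      have hd : d ≤ c + N ∨ c + 2 * N ≤ d := by
        by_contra hd
        have e5 := e.shift1
        rw [show c + N + N = c + 2 * N by ring] at e5
        exact M.nc (c + N) (c + 2 * N) d (p' + 2 * N) (by omega) (by omega) (by omega) (by omega)
          e5 Q.e4
      have hkS : k ∈ crossSet N χ c a b :=
        ⟨p', q', by omega, by omega, by omega, Q.hj, Or.inr ⟨by omega, by omega, by omega⟩⟩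
      refine ih (s := mutSeed k s) (χ := Function.update χ k (cl N b d)) ?_ (I.step L Q hki) ?_
      · have := ncard_drop (T := crossSet N (Function.update χ k (cl N b d)) c a b) hkS ?_
        · omega
        rintro l ⟨x, y, b1, b2, b3, b4, b5⟩
        have hl : l ≠ k := by
          rintro rfl
          rw [Function.update_self] at b4
          obtain ⟨t, ht, b4⟩ := cl_cases (by omega) b4
          omega
        rw [Function.update_of_ne hl] at b4
        exact ⟨hl, x, y, b1, b2, b3, b4, b5⟩
      · apply e.upd
        rw [Q.hj]
        intro h
        obtain ⟨t, ht, h⟩ := cl_cases (by omega) h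
        omega

/-- Chords separating `a` from the diameter `(c,c+N)`. -/
def sepSet (N : ℤ) (χ : Fin n → Cl N) (c a : ℤ) : Set (Fin n) :=
  {j | ∃ p q, c ≤ p ∧ p < a ∧ a < q ∧ q ≤ c + N ∧ χ j = cl N p q}

theorem SeedInv.stage1 (L : IsLam N lam) {c a b : ℤ} (h1 : c < a) (h2 : a < c + N) (h3 : c + N < b)
    (h4 : b ≤ a + N)
    (hnc : NC N β a b) (m : ℕ) : ∀ {s : Matrix (Fin n) (Fin n) ℤ × (Fin n → CAField n)}
    {χ : Fin n → Cl N}, (sepSet N χ c a).ncard ≤ m → SeedInv N lam B₀ i β s χ →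
    Ed N χ c (c + N) → ∃ s' χ', SeedInv N lam B₀ i β s' χ' ∧ Ed N χ' a b := by
  induction m with
  | zero =>
    intro s χ hm I e
    have hN := I.G.M.two_le
    obtain ⟨j, hj⟩ := e.label (by omega) (by omega)
    have h0 := (Set.ncard_eq_zero (Set.toFinite (sepSet N χ c a))).1 (by omega)
    have : j ∈ sepSet N χ c a := ⟨c, c + N, le_rfl, h1, h2, le_rfl, hj⟩
    rw [h0] at this
    exact this.elim
  | succ m ih =>
    intro s χ hm I e
    have M := I.G.M
    have hN := M.two_le
    obtain ⟨k, p', q', d, a1, a2, a3, a4, Q⟩ := M.descend (x := a) _ le_rfl h1 h2 (by omega) e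
    have q3 := Q.h3; have q4 := Q.h4
    have hki : k ≠ i := by
      rintro rfl
      exact hnc.left (Q.hj.symm.trans I.hi) ⟨by omega, by omega, by omega, by omega⟩
    have I' := I.step L Q hki
    by_cases hδ : p' = c ∧ q' = c + N
    · obtain ⟨rfl, rfl⟩ := hδ
      have hd := M.flip_diam Q rfl
      refine SeedInv.stage2 L (c := a) le_rfl (by omega) h4 hnc _ le_rfl I' ?_
      exact Ed.new (by rw [hd])
    have hd : d ≤ c + N ∨ c + 2 * N ≤ d := by
      by_contra hd
      by_cases hq : q' = c + N
      · have e5 := e.shift1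
        rw [show c + N + N = c + 2 * N by ring] at e5
        exact M.nc (c + N) (c + 2 * N) d (p' + 2 * N) (by omega) (by omega) (by omega) (by omega)
          e5 Q.e4
      · exact M.nc c (c + N) q' d (by omega) (by omega) (by omega) (by omega) e Q.e3
    have hkS : k ∈ sepSet N χ c a := ⟨p', q', by omega, by omega, by omega, by omega, Q.hj⟩
    refine ih (s := mutSeed k s) (χ := Function.update χ k (cl N a d)) ?_ I' ?_
    · have := ncard_drop (T := sepSet N (Function.update χ k (cl N a d)) c a) hkS ?_
      · omega
      rintro l ⟨x, y, b1, b2, b3, b4, b5⟩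
      have hl : l ≠ k := by
        rintro rfl
        rw [Function.update_self] at b5
        obtain ⟨t, ht, b5⟩ := cl_cases (by omega) b5
        omega
      rw [Function.update_of_ne hl] at b5
      exact ⟨hl, x, y, b1, b2, b3, b4, b5⟩
    · apply e.upd
      rw [Q.hj]
      intro h
      obtain ⟨t, ht, h⟩ := cl_cases (by omega) h
      omega

theorem SeedInv.reach_aux (L : IsLam N lam) (I : SeedInv N lam B₀ i β s χ) {a b : ℤ} (h1 : a < b)
    (h2 : b ≤ a + N) (hnc : NC N β a b) :
    ∃ s' χ', SeedInv N lam B₀ i β s' χ' ∧ Ed N χ' a b := by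
  obtain ⟨c₀, j, hj⟩ := I.G.M.diam
  have hN := I.G.M.two_le
  obtain ⟨c, hc, g1, g2⟩ : ∃ c, Ed N χ c (c + N) ∧ c ≤ a ∧ a < c + N := by
    have e : Ed N χ c₀ (c₀ + N) := Or.inr (Or.inr ⟨j, hj⟩)
    have e' := e.shift ((a - c₀) / N)
    have k1 := Int.emod_nonneg (a - c₀) (show N ≠ 0 by omega)
    have k2 := Int.emod_lt_of_pos (a - c₀) (show 0 < N by omega)
    have k3 := Int.emod_add_mul_ediv (a - c₀) N
    rw [mul_comm] at k3
    refine ⟨c₀ + (a - c₀) / N * N, ?_, by omega, by omega⟩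
    convert e' using 1
    ring
  by_cases hb : b ≤ c + N
  · exact SeedInv.stage2 L g1 h1 hb hnc _ le_rfl I hc
  · exact SeedInv.stage1 L (by omega) g2 (by omega) h2 hnc _ le_rfl I hc

theorem SeedInv.reach (L : IsLam N lam) (I : SeedInv N lam B₀ i β s χ) {a b : ℤ} (h1 : a < b)
    (h2 : b < a + 2 * N) (hnc : NC N β a b) :
    ∃ s' χ', SeedInv N lam B₀ i β s' χ' ∧ Ed N χ' a b := by
  by_cases h : b ≤ a + N
  · exact I.reach_aux L h1 h hnc
  · obtain ⟨s', χ', I', e⟩ := I.reach_aux L (a := b) (b := a + 2 * N) h2 (by omega) hnc.rot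
    exact ⟨s', χ', I', e.rot'⟩

theorem SeedInv.ord0 (L : IsLam N lam) (I : SeedInv N lam B₀ i β s χ) {a b : ℤ} (h1 : a < b)
    (h2 : b < a + 2 * N) (hnc : NC N β a b) (hne : cl N a b ≠ β) :
    HasOrd i (lam (cl N a b)) 0 := by
  obtain ⟨s', χ', I', e⟩ := I.reach L h1 h2 hnc
  have := I'.edge L e
  rwa [ind_neg] at this
  rw [I'.hi]; exact hne.symm

theorem SeedInv.ord1 (I : SeedInv N lam B₀ i β s χ) : HasOrd i (lam β) 1 := by
  rw [← I.hi, ← I.G.val i, I.ui]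
  exact HasOrd.uVar_self

theorem SeedInv.crossA (L : IsLam N lam) (I : SeedInv N lam B₀ i β s χ) {p q a b : ℤ} (hβ : cl N p q = β)
    (h1 : p < a) (h2 : a < q) (h3 : q < b) (h4 : b < p + 2 * N) (h5 : q ≤ p + N)
    (h6 : b ≤ p + N ∨ q + N ≤ b ∨ q = p + N) : HasOrd i (lam (cl N a b)) (-1) := by
  have hN : 0 < N := by omega
  have side : ∀ x y, ((x = p ∧ y = a) ∨ (x = a ∧ y = q) ∨ (x = q ∧ y = b) ∨
      (x = b ∧ y = p + 2 * N)) → HasOrd i (lam (cl N x y)) 0 := by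
    intro x y hxy
    apply I.ord0 L (by omega) (by omega)
    · intro p' q' hpq hcr
      obtain ⟨t, ht, h⟩ := cl_cases hN (hβ.trans hpq.symm)
      rcases hxy with ⟨rfl, rfl⟩ | ⟨rfl, rfl⟩ | ⟨rfl, rfl⟩ | ⟨rfl, rfl⟩ <;>
      rcases h with h | h <;> rcases ht with ht | ht | ht | ht | ht | ht | ht <;> omega
    · intro h
      obtain ⟨t, ht, h⟩ := cl_cases hN (hβ.trans h.symm)
      omega
  have hp := L.ptol p a q b h1 h2 h3 h4
  have hb := I.ord1
  rw [← hβ] at hb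
  have e : lam (cl N a b) = (lam (cl N p a) * lam (cl N q b) +
      lam (cl N a q) * lam (cl N b (p + 2 * N))) / lam (cl N p q) := by
    rw [eq_div_iff hb.ne_zero, ← hp, mul_comm]
  rw [e]
  have := ((((side p a (by simp)).mul (side q b (by simp))).add
    ((side a q (by simp)).mul (side b (p + 2 * N) (by simp)))).div hb)
  simpa using this

theorem SeedInv.crossB (L : IsLam N lam) (I : SeedInv N lam B₀ i β s χ) {p q a b : ℤ} (hβ : cl N p q = β)
    (h1 : p < a) (h2 : a < q) (h3 : q < b) (h4 : b < p + 2 * N) (h5 : q < p + N)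
    (h6 : p + N < b) (h7 : b < q + N) : HasOrd i (lam (cl N a b)) (-2) := by
  have hN : 0 < N := by omega
  have side : ∀ x y, ((x = p ∧ y = a) ∨ (x = a ∧ y = q)) → HasOrd i (lam (cl N x y)) 0 := by
    intro x y hxy
    apply I.ord0 L (by omega) (by omega)
    · intro p' q' hpq hcr
      obtain ⟨t, ht, h⟩ := cl_cases hN (hβ.trans hpq.symm)
      rcases hxy with ⟨rfl, rfl⟩ | ⟨rfl, rfl⟩ <;>
      rcases h with h | h <;> rcases ht with ht | ht | ht | ht | ht | ht | ht <;> omega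
    · intro h
      obtain ⟨t, ht, h⟩ := cl_cases hN (hβ.trans h.symm)
      omega
  have hβ' : cl N (p + N) (q + N) = β := by rw [cl_shift1, hβ]
  have s1 := I.crossA L hβ' (a := b) (b := q + 2 * N) h6 h7 (by omega) (by omega) (by omega) (by omega)
  rw [cl_rot] at s1
  have s2 := I.crossA L hβ' (a := b) (b := p + 2 * N) h6 h7 (by omega) (by omega) (by omega) (by omega)
  have hp := L.ptol p a q b h1 h2 h3 h4
  have hb := I.ord1
  rw [← hβ] at hb
  have e : lam (cl N a b) = (lam (cl N p a) * lam (cl N q b) +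
      lam (cl N a q) * lam (cl N b (p + 2 * N))) / lam (cl N p q) := by
    rw [eq_div_iff hb.ne_zero, ← hp, mul_comm]
  rw [e]
  have := ((((side p a (by simp)).mul s1).add
    ((side a q (by simp)).mul s2)).div hb)
  simpa using this

theorem SeedInv.cross (L : IsLam N lam) (I : SeedInv N lam B₀ i β s χ) {p q a b : ℤ} (hβ : cl N p q = β)
    (h1 : p < a) (h2 : a < q) (h3 : q < b) (h4 : b < p + 2 * N) (h5 : q ≤ p + N) :
    ∃ w < 0, HasOrd i (lam (cl N a b)) w := by
  by_cases h6 : b ≤ p + N ∨ q + N ≤ b ∨ q = p + N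
  · exact ⟨-1, by norm_num, I.crossA L hβ h1 h2 h3 h4 h5 h6⟩
  · exact ⟨-2, by norm_num, I.crossB L hβ h1 h2 h3 h4 (by omega) (by omega) (by omega)⟩

theorem SeedInv.cross' (L : IsLam N lam) (I : SeedInv N lam B₀ i β s χ) {a b : ℤ}
    (hnc : ¬ NC N β a b) : ∃ w < 0, HasOrd i (lam (cl N a b)) w := by
  unfold NC at hnc
  push Not at hnc
  obtain ⟨p, q, hβ, h1, h2, h3, h4⟩ := hnc
  by_cases h5 : q ≤ p + N
  · have := I.cross L hβ (a := b) (b := a + 2 * N) h2 h3 h4 (by omega) h5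
    rwa [cl_rot] at this
  · have := I.cross L (p := q) (q := p + 2 * N) (by rw [cl_rot, hβ]) (a := a + 2 * N)
      (b := b + 2 * N) h4 (by omega) (by omega) (by omega) (by omega)
    rwa [cl_shift2] at this

end reach

end proofs

/-- In a cluster pattern of type `C_n` (`n ≥ 2`), for a non-initial cluster
variable `y` with denominator vector `d`, one has `d i = 0` if and only if
some cluster of the pattern contains both `y` and the initial cluster
variable `u_i`. -/
theorem denominator_component_zero_iff_compatible_type_C {n : ℕ} (hn : 2 ≤ n)
    (B : Matrix (Fin n) (Fin n) ℤ) (hB : SkewSymmetrizable B)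
    (htype : PatternOfType (cartanC n) B) (y : CAField n)
    (hy : IsClusterVar B y) (hy0 : ∀ i, y ≠ uVar n i) (d : Fin n → ℤ)
    (hd : IsDenomVec (uVar n) y d) :
    ∀ i, d i = 0 ↔
      ∃ s, IsSeed B s ∧ (∃ j, s.2 j = y) ∧ (∃ j', s.2 j' = uVar n i) := by
  intro i
  obtain ⟨lam, χ, L, G⟩ := base_good hn hB htype
  have I : SeedInv ((n : ℤ) + 1) lam B i (χ i) (B, uVar n) χ :=
    ⟨Relation.ReflTransGen.refl, G, rfl, rfl, fun j hj => HasOrd.uVar_other hj⟩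
  constructor
  · intro hdi
    obtain ⟨s, hs, j, rfl⟩ := hy
    obtain ⟨χ', G'⟩ := G.forward L i hs
    obtain ⟨a, b, c, e, q⟩ := G'.M.quad j
    have hlen := G'.M.labelLen q.hj
    have hv : s.2 j = lam (cl _ a c) := by rw [G'.val j, q.hj]
    have hnc : NC ((n : ℤ) + 1) (χ i) a c := by
      by_contra h
      obtain ⟨w, hw, ho⟩ := I.cross' L h
      rw [← hv] at ho
      have := hd.ord ho
      omega
    obtain ⟨s', χ'', I', he⟩ := I.reach L (by omega) (by omega) hnc
    obtain ⟨k, hk⟩ := he.label (by omega) (by omega)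
    exact ⟨s', I'.seed, ⟨k, by rw [I'.G.val k, hk, hv]⟩, ⟨i, I'.ui⟩⟩
  · rintro ⟨s, hs, ⟨j, rfl⟩, ⟨j', hj'⟩⟩
    obtain ⟨χ', G'⟩ := G.forward L i hs
    obtain ⟨a, b, c, e, q⟩ := G'.M.quad j
    have hlen := G'.M.labelLen q.hj
    have hv : s.2 j = lam (cl _ a c) := by rw [G'.val j, q.hj]
    have hβ : χ' j' = χ i := by
      obtain ⟨a', b', c', e', q'⟩ := G'.M.quad j'
      have hlen' := G'.M.labelLen q'.hj
      have hv' : uVar n i = lam (cl _ a' c') := by rw [← hj', G'.val j', q'.hj]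
      have h1 : HasOrd i (uVar n i) 1 := HasOrd.uVar_self
      by_contra hne
      rw [q'.hj] at hne
      by_cases hnc : NC ((n : ℤ) + 1) (χ i) a' c'
      · have h0 := I.ord0 L (by omega) (by omega) hnc hne
        rw [← hv'] at h0
        have := h0.unique h1
        omega
      · obtain ⟨w, hw, ho⟩ := I.cross' L hnc
        rw [← hv'] at ho
        have := ho.unique h1
        omega
    have hnc : NC ((n : ℤ) + 1) (χ i) a c := by
      rintro p r hpr ⟨h1, h2, h3, h4⟩
      exact G'.M.nc a c p r h1 h2 h3 h4 (Or.inr (Or.inr ⟨j, q.hj⟩))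
        (Or.inr (Or.inr ⟨j', by rw [hβ, hpr]⟩))
    have hne : cl ((n : ℤ) + 1) a c ≠ χ i := by
      intro h
      apply hy0 i
      rw [hv, h, ← G.val i]
    have ho := I.ord0 L (by omega) (by omega) hnc hne
    rw [← hv] at ho
    have := hd.ord ho
    omega
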